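/- arXiv:math/0611321 — 4 statements merged into one kernel-verified Lean document; each statement's English description precedes it below -/
import Mathlib

section
/- Let $v_1, \dots, v_n$ be nonzero real numbers and let $\xi_1, \dots, \xi_n$ be i.i.d. random variables taking the values $+1$ and $-1$ each with probability $1/2$. Then for every real number $a$, the probability that $\sum_{i=1}^n \xi_i v_i = a$ is at most $\binom{n}{\lfloor n/2 \rfloor} / 2^n$. -/
/-- The coordinates where the sign `s i` agrees with the sign of `v i`, that is, those that
contribute `|v i|` to the signed sum. -/
noncomputable def signAgreement {ι : Type*} [Fintype ι] (v : ι → ℝ) (s : ι → Bool) : Finset ι :=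
  open Classical in {i | s i = true ↔ 0 < v i}

theorem mem_signAgreement {ι : Type*} [Fintype ι] {v : ι → ℝ} {s : ι → Bool} {i : ι} :
    i ∈ signAgreement v s ↔ (s i = true ↔ 0 < v i) := by
  simp [signAgreement]

theorem signAgreement_injective {ι : Type*} [Fintype ι] (v : ι → ℝ) :
    Function.Injective (signAgreement v) := by
  intro s t h
  ext i
  have hi := Finset.ext_iff.mp h i
  rw [mem_signAgreement, mem_signAgreement] at hi
  grind

/-- The signed sum is strictly increasing in the set of coordinates with agreeing signs. -/
theorem signedSum_lt_of_signAgreement_ssubset {ι : Type*} [Fintype ι] {v : ι → ℝ}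
    (hv : ∀ i, v i ≠ 0) {s t : ι → Bool} (h : signAgreement v s ⊂ signAgreement v t) :
    ∑ i, (if s i then v i else -v i) < ∑ i, (if t i then v i else -v i) := by
  have hsub := h.subset
  obtain ⟨j, hjt, hjs⟩ := Finset.exists_of_ssubset h
  refine Finset.sum_lt_sum (fun i _ => ?_) ⟨j, Finset.mem_univ j, ?_⟩
  · have hi := @hsub i
    rw [mem_signAgreement, mem_signAgreement] at hi
    by_cases hpos : 0 < v i <;> grind
  · rw [mem_signAgreement] at hjt hjs
    have hj := hv j
    by_cases hpos : 0 < v j <;> grind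

/-- **Erdős–Littlewood–Offord inequality.** If `v 1, …, v n` are nonzero real numbers
and `ξ i` are i.i.d. uniform `±1` signs (modeled by a uniform choice of
`s : Fin n → Bool`, with sign `+1` when `s i = true` and `-1` otherwise), then for
every real `a` the probability that `∑ i, ξ i * v i = a` is at most
`(n.choose ⌊n/2⌋) / 2 ^ n`. -/
theorem erdos_littlewood_offord (n : ℕ) (v : Fin n → ℝ) (hv : ∀ i, v i ≠ 0) (a : ℝ) :
    (Nat.card {s : Fin n → Bool // ∑ i, (if s i then v i else -v i) = a} : ℝ) / 2 ^ n ≤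
      (n.choose (n / 2) : ℝ) / 2 ^ n := by
  gcongr
  classical
  rw [Nat.card_eq_fintype_card, Fintype.card_subtype,
    ← Finset.card_image_of_injective _ (signAgreement_injective v)]
  conv_rhs => rw [← Fintype.card_fin n]
  apply IsAntichain.sperner
  intro A hA B hB hAB hle
  simp only [Finset.coe_image, Finset.coe_filter, Finset.mem_univ, true_and,
    Set.mem_image, Set.mem_ofPred_eq] at hA hB
  obtain ⟨s, hs, rfl⟩ := hA
  obtain ⟨t, ht, rfl⟩ := hB
  have hlt := signedSum_lt_of_signAgreement_ssubset hv
    (Finset.ssubset_iff_subset_ne.mpr ⟨hle, hAB⟩)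
  exact hlt.ne (hs.trans ht.symm)
end

section
/- There is an absolute constant $C > 0$ such that the following holds for every $n \geq 1$: if $v_1, \dots, v_n$ are nonzero and pairwise distinct real numbers and $\xi_1, \dots, \xi_n$ are i.i.d. random variables taking values $+1$ and $-1$ each with probability $1/2$, then for every real number $a$, $\mathbb{P}\left(\sum_{i=1}^n \xi_i v_i = a\right) \leq C n^{-3/2}$. -/
namespace LittlewoodOfford

open Finset
open scoped Pointwise

/-- The vector of deviations from `1` of the character values `ψ (x * w i)`. -/
noncomputable def phaseDeviation {R ι : Type*} [CommRing R] (ψ : AddChar R ℂ) (w : ι → R)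
    (x : R) : EuclideanSpace ℂ ι :=
  WithLp.toLp 2 fun i => 1 - ψ (x * w i)

section PhaseDeviation

variable {R ι : Type*} [CommRing R] [Fintype ι] (ψ : AddChar R ℂ) (w : ι → R)

lemma norm_phaseDeviation_sq (x : R) :
    ‖phaseDeviation ψ w x‖ ^ 2 = ∑ i, ‖1 - ψ (x * w i)‖ ^ 2 := by
  simp [phaseDeviation, EuclideanSpace.norm_sq_eq]

lemma norm_phaseDeviation_zero : ‖phaseDeviation ψ w 0‖ = 0 := by
  rw [← sq_eq_zero_iff, norm_phaseDeviation_sq]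
  simp

lemma norm_phaseDeviation_add_le [Finite R] (x y : R) :
    ‖phaseDeviation ψ w (x + y)‖ ≤ ‖phaseDeviation ψ w x‖ + ‖phaseDeviation ψ w y‖ := by
  let u : EuclideanSpace ℂ ι := WithLp.toLp 2 fun i => ψ (x * w i) * (1 - ψ (y * w i))
  have hu : ‖u‖ = ‖phaseDeviation ψ w y‖ := by
    rw [← sq_eq_sq₀ (norm_nonneg _) (norm_nonneg _), norm_phaseDeviation_sq,
      EuclideanSpace.norm_sq_eq]
    simp [u, AddChar.norm_apply]
  have hsum : phaseDeviation ψ w (x + y) = phaseDeviation ψ w x + u := by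
    ext i
    simp only [phaseDeviation, u, PiLp.add_apply, add_mul, AddChar.map_add_eq_mul]
    ring
  rw [hsum, ← hu]
  exact norm_add_le _ _

end PhaseDeviation

lemma addChar_map_sum {A M ι : Type*} [AddCommMonoid A] [CommMonoid M] (ψ : AddChar A M)
    (f : ι → A) (s : Finset ι) : ψ (∑ i ∈ s, f i) = ∏ i ∈ s, ψ (f i) := by
  classical
  induction s using Finset.induction_on with
  | empty => simp
  | insert i s hi ih => rw [sum_insert hi, prod_insert hi, AddChar.map_add_eq_mul, ih]

lemma sq_norm_one_add {z : ℂ} (hz : ‖z‖ = 1) : ‖1 + z‖ ^ 2 = 4 - ‖1 - z‖ ^ 2 := by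
  have h := parallelogram_law_with_norm ℝ (1 : ℂ) z
  rw [hz, norm_one] at h
  linarith

lemma norm_one_add_le {z : ℂ} (hz : ‖z‖ = 1) :
    ‖1 + z‖ ≤ 2 * Real.exp (-‖1 - z‖ ^ 2 / 8) := by
  refine le_of_sq_le_sq ?_ (by positivity)
  rw [mul_pow, ← Real.exp_nat_mul, sq_norm_one_add hz]
  have h := Real.add_one_le_exp (-‖1 - z‖ ^ 2 / 4)
  have he : ((2 : ℕ) : ℝ) * (-‖1 - z‖ ^ 2 / 8) = -‖1 - z‖ ^ 2 / 4 := by push_cast; ring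
  rw [he]
  linarith

lemma re_eq_one_sub_sq_norm {z : ℂ} (hz : ‖z‖ = 1) : z.re = 1 - ‖1 - z‖ ^ 2 / 2 := by
  have h : ‖z‖ ^ 2 = 1 := by rw [hz, one_pow]
  rw [← Complex.normSq_eq_norm_sq, Complex.normSq_apply] at h
  rw [← Complex.normSq_eq_norm_sq, Complex.normSq_apply]
  simp only [Complex.sub_re, Complex.one_re, Complex.sub_im, Complex.one_im]
  linarith

/-- Sublevel sets of a subadditive function on `ZMod p` grow at least linearly. -/
lemma min_le_card_sublevel {p : ℕ} [Fact p.Prime] {G : ZMod p → ℝ} (h0 : G 0 ≤ 0)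
    (hadd : ∀ x y, G (x + y) ≤ G x + G y) {r : ℝ} (hr : 0 ≤ r) (k : ℕ) :
    min p (k * (#{x | G x ≤ r} - 1) + 1) ≤ #{x | G x ≤ k * r} := by
  have hne (t : ℝ) (ht : 0 ≤ t) : ({x | G x ≤ t} : Finset (ZMod p)).Nonempty :=
    ⟨0, by simpa using h0.trans ht⟩
  induction k with
  | zero =>
    have := (hne ((0 : ℕ) * r) (by simp)).card_pos
    simp only [zero_mul, zero_add]
    omega
  | succ k ih =>
    have hk : 0 ≤ (k : ℝ) * r := by positivity
    have hcd := ZMod.cauchy_davenport (Fact.out : p.Prime) (hne _ hk) (hne r hr)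
    have hsub : ({x | G x ≤ k * r} : Finset (ZMod p)) +
        ({x | G x ≤ r} : Finset (ZMod p)) ⊆
        ({x | G x ≤ (k + 1 : ℕ) * r} : Finset (ZMod p)) := by
      intro z hz
      obtain ⟨x, hx, y, hy, rfl⟩ := mem_add.1 hz
      simp only [mem_filter, mem_univ, true_and] at hx hy ⊢
      push_cast
      linarith [hadd x y]
    have hcard := card_le_card hsub
    have h1 := (hne r hr).card_pos
    have h2 : (k + 1) * (#{x | G x ≤ r} - 1) = k * (#{x | G x ≤ r} - 1) + (#{x | G x ≤ r} - 1) :=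
      by ring
    rw [h2]
    omega

section Fourier

variable {p : ℕ} [Fact p.Prime] {ι : Type*} [Fintype ι] {ψ : AddChar (ZMod p) ℂ}

lemma sum_sq_norm_sum_char (hψ : ψ.IsPrimitive) {w : ι → ZMod p} (hw : Function.Injective w) :
    ∑ x, ‖∑ i, ψ (x * w i)‖ ^ 2 = p * Fintype.card ι := by
  classical
  rw [← Complex.ofReal_inj]
  push_cast
  have h (x : ZMod p) : ((‖∑ i, ψ (x * w i)‖ : ℂ)) ^ 2 =
      ∑ i, ∑ j, ψ (x * (w i - w j)) := by
    rw [← Complex.mul_conj', map_sum, sum_mul_sum]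
    refine sum_congr rfl fun i _ => sum_congr rfl fun j _ => ?_
    rw [← AddChar.map_neg_eq_conj, ← AddChar.map_add_eq_mul]
    congr 1
    ring
  simp_rw [h]
  rw [sum_comm]
  simp_rw [sum_comm (s := (univ : Finset (ZMod p))), AddChar.sum_mulShift _ hψ, sub_eq_zero,
    hw.eq_iff]
  simp [ZMod.card, mul_comm]

lemma card_phaseDeviation_sq_le_card (hψ : ψ.IsPrimitive) {w : ι → ZMod p}
    (hw : Function.Injective w) :
    (#{x | ‖phaseDeviation ψ w x‖ ^ 2 ≤ Fintype.card ι} : ℝ) * Fintype.card ι ^ 2 ≤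
      4 * p * Fintype.card ι := by
  have hlarge (x : ZMod p) (hx : ‖phaseDeviation ψ w x‖ ^ 2 ≤ Fintype.card ι) :
      (Fintype.card ι : ℝ) ^ 2 ≤ 4 * ‖∑ i, ψ (x * w i)‖ ^ 2 := by
    have hre : (∑ i, ψ (x * w i)).re = Fintype.card ι - ‖phaseDeviation ψ w x‖ ^ 2 / 2 := by
      rw [Complex.re_sum, norm_phaseDeviation_sq,
        sum_congr rfl fun i _ => re_eq_one_sub_sq_norm (ψ.norm_apply (x * w i)),
        sum_sub_distrib, sum_div]
      simp
    have hle := Complex.re_le_norm (∑ i, ψ (x * w i))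
    have hn : (0 : ℝ) ≤ Fintype.card ι := by positivity
    nlinarith
  calc (#{x | ‖phaseDeviation ψ w x‖ ^ 2 ≤ Fintype.card ι} : ℝ) * Fintype.card ι ^ 2
      = ∑ x with ‖phaseDeviation ψ w x‖ ^ 2 ≤ Fintype.card ι, (Fintype.card ι : ℝ) ^ 2 := by
        simp
    _ ≤ ∑ x with ‖phaseDeviation ψ w x‖ ^ 2 ≤ Fintype.card ι, 4 * ‖∑ i, ψ (x * w i)‖ ^ 2 :=
        sum_le_sum fun x hx => hlarge x (mem_filter.1 hx).2
    _ ≤ ∑ x, 4 * ‖∑ i, ψ (x * w i)‖ ^ 2 :=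
        sum_le_sum_of_subset_of_nonneg (filter_subset _ _) fun _ _ _ => by positivity
    _ = 4 * p * Fintype.card ι := by
        rw [← mul_sum, sum_sq_norm_sum_char hψ hw, mul_assoc]

lemma card_phaseDeviation_sq_le (hψ : ψ.IsPrimitive) {w : ι → ZMod p}
    (hw : Function.Injective w) (hcard : 4 < Fintype.card ι) {m : ℕ} (hm : 1 ≤ m)
    (hmn : m ≤ Fintype.card ι) :
    (#{x | ‖phaseDeviation ψ w x‖ ^ 2 ≤ m} : ℝ) ≤
      1 + 8 * p * m / (Fintype.card ι * √(Fintype.card ι)) := by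
  set n := Fintype.card ι
  have hn : (4 : ℝ) < n := by exact_mod_cast hcard
  have hp : (0 : ℝ) < p := by exact_mod_cast (Fact.out : p.Prime).pos
  have hm0 : (1 : ℝ) ≤ m := by exact_mod_cast hm
  set k := Nat.sqrt (n / m)
  have hk1 : 1 ≤ k := Nat.le_sqrt.2 (by simpa using (Nat.one_le_div_iff hm).2 hmn)
  have hk2 : k * k * m ≤ n :=
    (Nat.le_div_iff_mul_le hm).1 (Nat.sqrt_le (n / m))
  have hk3 : n < (k + 1) * (k + 1) * m :=
    (Nat.div_lt_iff_lt_mul hm).1 (Nat.lt_succ_sqrt (n / m))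
  have hk1' : (1 : ℝ) ≤ k := by exact_mod_cast hk1
  have hk2' : (k : ℝ) * k * m ≤ n := by exact_mod_cast hk2
  have hk3' : (n : ℝ) < (k + 1) * (k + 1) * m := by exact_mod_cast hk3
  have hsqrt : √(n : ℝ) ≤ 2 * m * k := by
    refine Real.sqrt_le_iff.2 ⟨by positivity, hk3'.le.trans ?_⟩
    have h1 : ((k : ℝ) + 1) * (k + 1) ≤ 4 * k ^ 2 := by nlinarith
    have h2 : (m : ℝ) ≤ m ^ 2 := by nlinarith
    calc ((k : ℝ) + 1) * (k + 1) * m ≤ 4 * k ^ 2 * m ^ 2 := by gcongr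
      _ = (2 * m * k) ^ 2 := by ring
  have hlev (t : ℝ) (ht : 0 ≤ t) (x : ZMod p) :
      ‖phaseDeviation ψ w x‖ ^ 2 ≤ t ↔ ‖phaseDeviation ψ w x‖ ≤ √t :=
    (Real.le_sqrt (norm_nonneg _) ht).symm
  have hgrow := min_le_card_sublevel (G := fun x => ‖phaseDeviation ψ w x‖)
    (norm_phaseDeviation_zero ψ w).le
    (norm_phaseDeviation_add_le ψ w) (Real.sqrt_nonneg m) k
  have hsub : #{x | ‖phaseDeviation ψ w x‖ ≤ k * √(m : ℝ)} ≤
      #{x | ‖phaseDeviation ψ w x‖ ^ 2 ≤ n} := by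
    refine card_le_card fun x hx => ?_
    simp only [mem_filter, mem_univ, true_and] at hx ⊢
    calc ‖phaseDeviation ψ w x‖ ^ 2 ≤ (k * √(m : ℝ)) ^ 2 := by gcongr
      _ = (k : ℝ) * k * m := by rw [mul_pow, Real.sq_sqrt (by positivity)]; ring
      _ ≤ (n : ℝ) := hk2'
  have htop : (#{x | ‖phaseDeviation ψ w x‖ ^ 2 ≤ n} : ℝ) * n ≤ 4 * p := by
    have := card_phaseDeviation_sq_le_card hψ hw
    refine le_of_mul_le_mul_right (a := (n : ℝ)) ?_ (by linarith)
    linarith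
  have hlt : #{x | ‖phaseDeviation ψ w x‖ ^ 2 ≤ n} < p := by
    by_contra! hle
    have hle' : (p : ℝ) ≤ #{x | ‖phaseDeviation ψ w x‖ ^ 2 ≤ n} := by exact_mod_cast hle
    nlinarith
  simp_rw [hlev m (by positivity)]
  set N := #{x | ‖phaseDeviation ψ w x‖ ≤ √(m : ℝ)}
  have hkN : k * (N - 1) ≤ #{x | ‖phaseDeviation ψ w x‖ ^ 2 ≤ n} := by omega
  have hkN' : (k : ℝ) * (N - 1) ≤ #{x | ‖phaseDeviation ψ w x‖ ^ 2 ≤ n} := by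
    have h1 : (N : ℝ) - 1 ≤ (N - 1 : ℕ) := by
      have : N ≤ (N - 1) + 1 := by omega
      have : (N : ℝ) ≤ (N - 1 : ℕ) + 1 := by exact_mod_cast this
      linarith
    calc (k : ℝ) * (N - 1) ≤ k * (N - 1 : ℕ) := by gcongr
      _ ≤ _ := by exact_mod_cast hkN
  have hfin : (N : ℝ) - 1 ≤ 8 * p * m / (n * √(n : ℝ)) := by
    rcases le_total (N : ℝ) 1 with h | h
    · exact (sub_nonpos.2 h).trans (by positivity)
    rw [le_div_iff₀ (by positivity)]
    calc ((N : ℝ) - 1) * (n * √(n : ℝ)) ≤ (N - 1) * (n * (2 * m * k)) := by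
          have := sub_nonneg.2 h
          gcongr
      _ = k * (N - 1) * n * (2 * m) := by ring
      _ ≤ 4 * p * (2 * m) := by
          have : (k : ℝ) * (N - 1) * n ≤ 4 * p := le_trans (by gcongr) htop
          gcongr
      _ = 8 * p * m := by ring
  linarith

/-- The constant in the bound for the exponential sum of squared phase deviations. -/
noncomputable def levelConstant : ℝ :=
  128 + 9 * ∑' m : ℕ, ((m : ℝ) + 1) * Real.exp (-1 / 8) ^ m

lemma summable_level : Summable fun m : ℕ => ((m : ℝ) + 1) * Real.exp (-1 / 8) ^ m := by
  have hr : ‖Real.exp (-1 / 8)‖ < 1 := by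
    rw [Real.norm_eq_abs, Real.abs_exp]
    exact Real.exp_lt_one_iff.2 (by norm_num)
  simpa [add_mul] using (summable_pow_mul_geometric_of_norm_lt_one 1 hr).add
    (summable_geometric_of_norm_lt_one hr)

lemma levelConstant_pos : 0 < levelConstant := by
  have : 0 ≤ ∑' m : ℕ, ((m : ℝ) + 1) * Real.exp (-1 / 8) ^ m :=
    tsum_nonneg fun m => by positivity
  unfold levelConstant
  linarith

lemma exp_neg_le_sum_levels {t : ℝ} (ht : 0 ≤ t) (n : ℕ) :
    Real.exp (-t / 8) ≤ Real.exp (-n / 8) +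
      ∑ m ∈ range n, if t ≤ (m + 1 : ℕ) then Real.exp (-1 / 8) ^ m else 0 := by
  have hnonneg (m : ℕ) : 0 ≤ if t ≤ (m + 1 : ℕ) then Real.exp (-1 / 8) ^ m else 0 := by
    split_ifs <;> positivity
  rcases le_or_gt (n : ℝ) t with h | h
  · have h1 : Real.exp (-t / 8) ≤ Real.exp (-n / 8) := Real.exp_le_exp.2 (by linarith)
    linarith [sum_nonneg fun m (_ : m ∈ range n) => hnonneg m]
  · have hmem : ⌊t⌋₊ ∈ range n := mem_range.2 ((Nat.floor_lt ht).2 h)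
    have h1 := single_le_sum (fun m _ => hnonneg m) hmem
    rw [if_pos (by push_cast; exact (Nat.lt_floor_add_one t).le)] at h1
    have h2 : Real.exp (-t / 8) ≤ Real.exp (-1 / 8) ^ ⌊t⌋₊ := by
      rw [← Real.exp_nat_mul]
      exact Real.exp_le_exp.2 (by linarith [Nat.floor_le ht])
    linarith [Real.exp_pos (-(n : ℝ) / 8)]

lemma sum_exp_phaseDeviation_le (hψ : ψ.IsPrimitive) {w : ι → ZMod p}
    (hw : Function.Injective w) (hcard : 4 < Fintype.card ι) (hp : Fintype.card ι ^ 2 ≤ p) :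
    ∑ x, Real.exp (-‖phaseDeviation ψ w x‖ ^ 2 / 8) ≤
      levelConstant * (p / (Fintype.card ι * √(Fintype.card ι))) := by
  set n := Fintype.card ι
  set Q : ℝ := p / (n * √(n : ℝ))
  have hn : (4 : ℝ) < n := by exact_mod_cast hcard
  have hp' : (n : ℝ) ^ 2 ≤ p := by exact_mod_cast hp
  have hsqrt : √(n : ℝ) ≤ n := Real.sqrt_le_iff.2 ⟨by positivity, by nlinarith⟩
  have hnn : n * √(n : ℝ) ≤ n ^ 2 := by rw [sq]; gcongr
  have hs0 : 0 < √(n : ℝ) := Real.sqrt_pos.2 (by linarith)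
  have hQ : 1 ≤ Q := (one_le_div (by positivity)).2 (hnn.trans hp')
  have htail : p * Real.exp (-n / 8) ≤ 128 * Q := by
    have h1 : (n : ℝ) ^ 2 / 128 ≤ Real.exp (n / 8) := by
      have := Real.quadratic_le_exp_of_nonneg (x := (n : ℝ) / 8) (by positivity)
      nlinarith
    have h2 : Real.exp (-n / 8) ≤ 128 / n ^ 2 := by
      rw [neg_div, Real.exp_neg, inv_le_comm₀ (Real.exp_pos _) (by positivity), inv_div]
      exact h1
    calc p * Real.exp (-n / 8) ≤ p * (128 / n ^ 2) := by gcongr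
      _ ≤ p * (128 / (n * √(n : ℝ))) := by gcongr
      _ = 128 * Q := by simp only [Q]; ring
  have hlevel (m : ℕ) (hm : m ∈ range n) :
      Real.exp (-1 / 8) ^ m * #{x | ‖phaseDeviation ψ w x‖ ^ 2 ≤ (m + 1 : ℕ)} ≤
        9 * Q * ((m + 1) * Real.exp (-1 / 8) ^ m) := by
    have h1 := card_phaseDeviation_sq_le hψ hw hcard (m := m + 1) (by omega)
      (Nat.succ_le_of_lt (mem_range.1 hm))
    have h2 : 8 * p * (m + 1 : ℕ) / (n * √(n : ℝ)) = 8 * Q * (m + 1) := by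
      simp only [Q]; push_cast; ring
    have h3 : (#{x | ‖phaseDeviation ψ w x‖ ^ 2 ≤ (m + 1 : ℕ)} : ℝ) ≤ 9 * Q * (m + 1) := by
      have hm0 : (0 : ℝ) ≤ m := by positivity
      rw [h2] at h1
      nlinarith
    calc _ ≤ Real.exp (-1 / 8) ^ m * (9 * Q * (m + 1)) := by gcongr
      _ = _ := by ring
  calc ∑ x, Real.exp (-‖phaseDeviation ψ w x‖ ^ 2 / 8)
      ≤ ∑ x, (Real.exp (-n / 8) + ∑ m ∈ range n,
          if ‖phaseDeviation ψ w x‖ ^ 2 ≤ (m + 1 : ℕ) then Real.exp (-1 / 8) ^ m else 0) :=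
        sum_le_sum fun x _ => exp_neg_le_sum_levels (sq_nonneg _) n
    _ = p * Real.exp (-n / 8) + ∑ m ∈ range n, Real.exp (-1 / 8) ^ m *
          #{x | ‖phaseDeviation ψ w x‖ ^ 2 ≤ (m + 1 : ℕ)} := by
        rw [sum_add_distrib, sum_comm]
        simp [ZMod.card, ← sum_filter, mul_comm]
    _ ≤ 128 * Q + ∑ m ∈ range n, 9 * Q * ((m + 1) * Real.exp (-1 / 8) ^ m) :=
        add_le_add htail (sum_le_sum hlevel)
    _ ≤ 128 * Q + 9 * Q * ∑' m : ℕ, ((m : ℝ) + 1) * Real.exp (-1 / 8) ^ m := by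
        rw [← mul_sum]
        gcongr
        exact summable_level.sum_le_tsum _ fun m _ => by positivity
    _ = levelConstant * Q := by unfold levelConstant; ring

lemma mul_card_subset_sum_le (hψ : ψ.IsPrimitive) (w : ι → ZMod p) (b : ZMod p) :
    (p : ℝ) * #{s : Finset ι | ∑ i ∈ s, w i = b} ≤
      2 ^ Fintype.card ι * ∑ x, Real.exp (-‖phaseDeviation ψ w x‖ ^ 2 / 8) := by
  classical
  have hfourier : (p : ℂ) * #{s : Finset ι | ∑ i ∈ s, w i = b} =
      ∑ x, ψ (-(x * b)) * ∏ i, (1 + ψ (x * w i)) := by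
    have h (x : ZMod p) : ψ (-(x * b)) * ∏ i, (1 + ψ (x * w i)) =
        ∑ s : Finset ι, ψ (x * (∑ i ∈ s, w i - b)) := by
      rw [prod_one_add, powerset_univ, mul_sum]
      refine sum_congr rfl fun s _ => ?_
      rw [mul_sub, sub_eq_neg_add, AddChar.map_add_eq_mul, mul_sum, addChar_map_sum]
    simp_rw [h]
    rw [sum_comm]
    simp_rw [AddChar.sum_mulShift _ hψ, sub_eq_zero]
    simp [ZMod.card, ← sum_filter, mul_comm]
  have hbound (x : ZMod p) : ‖ψ (-(x * b)) * ∏ i, (1 + ψ (x * w i))‖ ≤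
      2 ^ Fintype.card ι * Real.exp (-‖phaseDeviation ψ w x‖ ^ 2 / 8) := by
    rw [norm_mul, AddChar.norm_apply, one_mul, norm_prod]
    calc ∏ i, ‖1 + ψ (x * w i)‖ ≤ ∏ i, 2 * Real.exp (-‖1 - ψ (x * w i)‖ ^ 2 / 8) :=
          prod_le_prod (fun _ _ => norm_nonneg _) fun i _ => norm_one_add_le (ψ.norm_apply _)
      _ = _ := by
          rw [prod_mul_distrib, ← Real.exp_sum, norm_phaseDeviation_sq, ← sum_div,
            sum_neg_distrib]
          simp
  calc (p : ℝ) * #{s : Finset ι | ∑ i ∈ s, w i = b}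
      = ‖(p : ℂ) * #{s : Finset ι | ∑ i ∈ s, w i = b}‖ := by simp
    _ ≤ ∑ x, 2 ^ Fintype.card ι * Real.exp (-‖phaseDeviation ψ w x‖ ^ 2 / 8) := by
        rw [hfourier]
        exact norm_sum_le_of_le _ fun x _ => hbound x
    _ = _ := by rw [mul_sum]

/-- The subset sums of at least five distinct residues modulo a large prime are spread out. -/
theorem card_subset_sum_zmod_le {w : ι → ZMod p} (hw : Function.Injective w)
    (hcard : 4 < Fintype.card ι) (hp : Fintype.card ι ^ 2 ≤ p) (b : ZMod p) :
    (#{s : Finset ι | ∑ i ∈ s, w i = b} : ℝ) ≤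
      2 ^ Fintype.card ι * (levelConstant / (Fintype.card ι * √(Fintype.card ι))) := by
  have hψ := ZMod.isPrimitive_stdAddChar p
  have hp0 : (0 : ℝ) < p := by exact_mod_cast (Fact.out : p.Prime).pos
  refine le_of_mul_le_mul_left ?_ hp0
  calc (p : ℝ) * #{s : Finset ι | ∑ i ∈ s, w i = b}
      ≤ 2 ^ Fintype.card ι * (levelConstant * (p / (Fintype.card ι * √(Fintype.card ι)))) :=
        (mul_card_subset_sum_le hψ w b).trans
          (by gcongr; exact sum_exp_phaseDeviation_le hψ hw hcard hp)
    _ = _ := by ring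

end Fourier

/-- Subset sums of distinct reals embed into subset sums of distinct residues modulo a prime. -/
lemma exists_zmod_card_subset_sum_le {ι : Type*} [Fintype ι] {v : ι → ℝ}
    (hv : Function.Injective v) (c : ℝ) (B : ℕ) :
    ∃ p, B ≤ p ∧ p.Prime ∧ ∃ (w : ι → ZMod p) (b : ZMod p), Function.Injective w ∧
      #{s : Finset ι | ∑ i ∈ s, v i = c} ≤ #{s : Finset ι | ∑ i ∈ s, w i = b} := by
  classical
  obtain ⟨f, hf⟩ := Module.exists_dual_forall_apply_ne_zero (K := ℚ)
    (fun q : {q : ι × ι // q.1 ≠ q.2} => v q.1.1 - v q.1.2)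
    fun q => sub_ne_zero.2 (hv.ne q.2)
  obtain ⟨d, hd⟩ := IsLocalization.exist_integer_multiples_of_finite (nonZeroDivisors ℤ)
    fun i => f (v i)
  choose z hz using hd
  have hd0 : ((d : ℤ) : ℚ) ≠ 0 := by exact_mod_cast nonZeroDivisors.ne_zero d.2
  have hz' (i : ι) : (z i : ℚ) = (d : ℤ) * f (v i) := by simpa using hz i
  have hzinj : Function.Injective z := by
    intro i j hij
    by_contra hne
    refine hf ⟨(i, j), hne⟩ ?_
    have h : ((d : ℤ) : ℚ) * f (v i) = (d : ℤ) * f (v j) := by rw [← hz', ← hz', hij]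
    rw [map_sub, mul_left_cancel₀ hd0 h, sub_self]
  have hzsum (s : Finset ι) : ((∑ i ∈ s, z i : ℤ) : ℚ) = (d : ℤ) * f (∑ i ∈ s, v i) := by
    push_cast
    simp_rw [hz', map_sum, mul_sum]
  obtain ⟨p, hpB, hp⟩ := Nat.exists_infinite_primes (B + 2 * ∑ i, (z i).natAbs + 1)
  have hwinj : Function.Injective fun i => (z i : ZMod p) := by
    intro i j hij
    refine hzinj (sub_eq_zero.1 (Int.eq_zero_of_abs_lt_dvd (m := p) ?_ ?_))
    · rw [← ZMod.intCast_zmod_eq_zero_iff_dvd]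
      simpa [sub_eq_zero] using hij
    · have hi := single_le_sum (f := fun i => (z i).natAbs) (fun _ _ => Nat.zero_le _) (mem_univ i)
      have hj := single_le_sum (f := fun i => (z i).natAbs) (fun _ _ => Nat.zero_le _) (mem_univ j)
      rw [abs_lt]
      omega
  refine ⟨p, by omega, hp, fun i => (z i : ZMod p), ?_⟩
  rcases ({s : Finset ι | ∑ i ∈ s, v i = c} : Finset (Finset ι)).eq_empty_or_nonempty with
    h | ⟨t, ht⟩
  · exact ⟨0, hwinj, by simp [h]⟩
  · refine ⟨∑ i ∈ t, (z i : ZMod p), hwinj, card_le_card fun s hs => ?_⟩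
    simp only [mem_filter, mem_univ, true_and] at hs ht ⊢
    have h : ∑ i ∈ s, z i = ∑ i ∈ t, z i := by
      have : ((∑ i ∈ s, z i : ℤ) : ℚ) = (∑ i ∈ t, z i : ℤ) := by rw [hzsum, hzsum, hs, ht]
      exact_mod_cast this
    exact_mod_cast congrArg (Int.cast : ℤ → ZMod p) h

lemma natCard_signed_sum_le {ι : Type*} [Fintype ι] (v : ι → ℝ) (a : ℝ) :
    Nat.card {s : ι → Bool // ∑ i, (if s i then v i else -v i) = a} ≤
      #{s : Finset ι | ∑ i ∈ s, v i = (a + ∑ i, v i) / 2} := by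
  classical
  rw [Nat.card_eq_fintype_card, Fintype.card_subtype]
  refine card_le_card_of_injOn (fun s => ({i | s i} : Finset ι)) ?_ ?_
  · intro s hs
    simp only [coe_filter, mem_univ, true_and, Set.mem_ofPred_eq] at hs ⊢
    rw [← hs, sum_filter, ← sum_add_distrib, sum_div]
    refine sum_congr rfl fun i _ => ?_
    split_ifs <;> ring
  · intro s _ t _ hst
    ext i
    have := Finset.ext_iff.1 hst i
    rw [Bool.eq_iff_iff]
    simpa only [mem_filter, mem_univ, true_and] using this

end LittlewoodOfford


/-- **Erdős–Moser / Sárközy–Szemerédi bound.** There is an absolute constant `C > 0` such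
that for every `n ≥ 1`, if `v 1, …, v n` are nonzero, pairwise distinct real numbers and
`ξ i` are i.i.d. uniform `±1` signs (modeled by a uniform `s : Fin n → Bool`), then for
every real `a` the probability that `∑ i, ξ i * v i = a` is at most `C * n ^ (-3/2)`. -/
theorem sarkozy_szemeredi : ∃ C : ℝ, 0 < C ∧ ∀ n : ℕ, 1 ≤ n →
    ∀ v : Fin n → ℝ, (∀ i, v i ≠ 0) → Function.Injective v → ∀ a : ℝ,
      (Nat.card {s : Fin n → Bool // ∑ i, (if s i then v i else -v i) = a} : ℝ) / 2 ^ n ≤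
        C * (n : ℝ) ^ (-(3 : ℝ) / 2) := by
  obtain hK := LittlewoodOfford.levelConstant_pos
  refine ⟨LittlewoodOfford.levelConstant + 8, by linarith, fun n hn v _ hv a => ?_⟩
  have hn0 : (0 : ℝ) < n := by exact_mod_cast hn
  have hpow : (n : ℝ) ^ (-(3 : ℝ) / 2) = 1 / (n * √(n : ℝ)) := by
    rw [neg_div, Real.rpow_neg hn0.le, one_div, Real.sqrt_eq_rpow,
      show (3 : ℝ) / 2 = 1 + 1 / 2 by norm_num, Real.rpow_add hn0, Real.rpow_one]
  have hs0 : 0 < √(n : ℝ) := Real.sqrt_pos.2 hn0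
  rw [hpow, div_le_iff₀ (by positivity), mul_one_div]
  rcases lt_or_ge 4 n with h | h
  · obtain ⟨p, hpn, hp, w, b, hw, hle⟩ := LittlewoodOfford.exists_zmod_card_subset_sum_le hv
      ((a + ∑ i, v i) / 2) (n ^ 2)
    have : Fact p.Prime := ⟨hp⟩
    have hbound := LittlewoodOfford.card_subset_sum_zmod_le hw (by simpa using h)
      (by simpa using hpn) b
    rw [Fintype.card_fin] at hbound
    calc _ ≤ _ := Nat.cast_le.2 ((LittlewoodOfford.natCard_signed_sum_le v a).trans hle)
      _ ≤ _ := hbound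
      _ ≤ 2 ^ n * ((LittlewoodOfford.levelConstant + 8) / (n * √(n : ℝ))) := by
          gcongr
          linarith
      _ = _ := mul_comm _ _
  · have hn4 : (n : ℝ) ≤ 4 := by exact_mod_cast h
    have hsqrt : √(n : ℝ) ≤ 2 := Real.sqrt_le_iff.2 ⟨by norm_num, by linarith⟩
    have hone : 1 ≤ (LittlewoodOfford.levelConstant + 8) / (n * √(n : ℝ)) := by
      rw [one_le_div (by positivity)]
      nlinarith
    have hcard : Nat.card {s : Fin n → Bool // ∑ i, (if s i then v i else -v i) = a} ≤ 2 ^ n := by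
      simpa using Nat.card_le_card_of_injective
        (Subtype.val : {s : Fin n → Bool // ∑ i, (if s i then v i else -v i) = a} → _)
        Subtype.val_injective
    calc _ ≤ ((2 ^ n : ℕ) : ℝ) := Nat.cast_le.2 hcard
      _ = 1 * 2 ^ n := by push_cast; ring
      _ ≤ _ := by gcongr
end

section
/- There is an absolute constant $C > 0$ such that the following holds for every $n \geq 1$: if $c_{ij}$, $1 \leq i \leq j \leq n$, are nonzero real numbers and $\xi_1, \dots, \xi_n$ are i.i.d. random variables taking values $+1$ and $-1$ each with probability $1/2$, then for the quadratic form $F = \sum_{1 \leq i \leq j \leq n} c_{ij} \xi_i \xi_j$ and for every real number $a$, one has $\mathbb{P}(F = a) \leq C n^{-1/8}$. -/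
open Finset

/-- The real sign `±1` encoded by a Boolean. -/
def boolSign (b : Bool) : ℝ := if b then 1 else -1

lemma centralBinom_sq_mul_le (k : ℕ) : k.centralBinom ^ 2 * (2 * k + 1) ≤ 16 ^ k := by
  induction k with
  | zero => simp
  | succ k ih =>
    have h := Nat.succ_mul_centralBinom_succ k
    have hpos : 0 < (k + 1) ^ 2 := by positivity
    refine Nat.le_of_mul_le_mul_left ?_ hpos
    calc (k + 1) ^ 2 * ((k + 1).centralBinom ^ 2 * (2 * (k + 1) + 1))
        = ((k + 1) * (k + 1).centralBinom) ^ 2 * (2 * k + 3) := by ring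
      _ = (k.centralBinom ^ 2 * (2 * k + 1)) * (4 * ((2 * k + 1) * (2 * k + 3))) := by
          rw [h]; ring
      _ ≤ 16 ^ k * (4 * (4 * (k + 1) ^ 2)) :=
          Nat.mul_le_mul ih (by nlinarith)
      _ = (k + 1) ^ 2 * 16 ^ (k + 1) := by ring

lemma choose_half_sq_mul_le (n : ℕ) : n.choose (n / 2) ^ 2 * n ≤ 4 ^ n := by
  obtain ⟨k, rfl | rfl⟩ := Nat.even_or_odd' n
  · have h := centralBinom_sq_mul_le k
    rw [Nat.centralBinom_eq_two_mul_choose] at h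
    rw [Nat.mul_div_cancel_left k two_pos, pow_mul]
    norm_num
    nlinarith
  · have h := centralBinom_sq_mul_le (k + 1)
    have h2 : (k + 1).centralBinom = 2 * (2 * k + 1).choose k := by
      rw [Nat.centralBinom_eq_two_mul_choose, show 2 * (k + 1) = (2 * k + 1) + 1 by ring,
        Nat.choose_succ_succ, Nat.choose_symm_half]
      ring
    rw [h2] at h
    rw [show (2 * k + 1) / 2 = k by omega, pow_succ 4, pow_mul]
    norm_num
    rw [pow_succ 16] at h
    nlinarith

/-- The **Littlewood–Offord inequality** of Erdős, in its sharp form. -/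
lemma card_sum_mul_boolSign_eq_le_choose {ι : Type*} [Fintype ι] [DecidableEq ι] (a : ι → ℝ)
    (ha : ∀ i, a i ≠ 0) (b : ℝ) :
    #{s : ι → Bool | ∑ i, a i * boolSign (s i) = b} ≤
      (Fintype.card ι).choose (Fintype.card ι / 2) := by
  classical
  let φ : (ι → Bool) → Finset ι := fun s => {i | 0 < a i * boolSign (s i)}
  have hsum : ∀ s i, a i * boolSign (s i) = if i ∈ φ s then |a i| else -|a i| := by
    intro s i
    simp only [φ, mem_filter, mem_univ, true_and]
    rcases lt_or_gt_of_ne (ha i) with h | h <;> cases s i <;>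
      simp [boolSign, abs_of_neg, abs_of_pos, h, h.le, not_lt]
  have hinj : Function.Injective φ := by
    intro s t hst
    funext i
    have h : a i * boolSign (s i) = a i * boolSign (t i) := by rw [hsum, hsum, hst]
    have h' := mul_left_cancel₀ (ha i) h
    revert h'
    cases s i <;> cases t i <;> norm_num [boolSign]
  rw [← card_image_of_injective _ hinj]
  refine IsAntichain.sperner ?_
  rintro A hA B hB hne hAB
  simp only [coe_image, Set.mem_image, mem_coe, mem_filter, mem_univ, true_and] at hA hB
  obtain ⟨s, hs, rfl⟩ := hA
  obtain ⟨t, ht, rfl⟩ := hB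
  obtain ⟨i, hit, his⟩ := exists_of_ssubset (hAB.lt_of_ne hne)
  have : ∑ i, a i * boolSign (s i) < ∑ i, a i * boolSign (t i) := by
    refine sum_lt_sum (fun j _ => ?_) ⟨i, mem_univ i, ?_⟩
    · rw [hsum, hsum]
      by_cases hj : j ∈ φ s
      · rw [if_pos hj, if_pos (hAB hj)]
      · rw [if_neg hj]
        split_ifs
        · linarith [abs_nonneg (a j)]
        · rfl
    · rw [hsum, hsum, if_pos hit, if_neg his]
      linarith [abs_pos.2 (ha i)]
  linarith

lemma card_sum_mul_boolSign_eq_mul_sqrt_card_le {ι : Type*} [Fintype ι] [DecidableEq ι]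
    (a : ι → ℝ) (ha : ∀ i, a i ≠ 0) (b : ℝ) :
    (#{s : ι → Bool | ∑ i, a i * boolSign (s i) = b} : ℝ) * √(Fintype.card ι) ≤
      2 ^ Fintype.card ι := by
  have h1 := card_sum_mul_boolSign_eq_le_choose a ha b
  have h2 : (((Fintype.card ι).choose (Fintype.card ι / 2) : ℝ)) ^ 2 * Fintype.card ι
      ≤ 4 ^ Fintype.card ι := by exact_mod_cast choose_half_sq_mul_le (Fintype.card ι)
  refine le_trans (mul_le_mul_of_nonneg_right (Nat.cast_le.2 h1) (Real.sqrt_nonneg _)) ?_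
  refine abs_le_of_sq_le_sq' ?_ (by positivity) |>.2
  rw [mul_pow, Real.sq_sqrt (by positivity), ← pow_mul, mul_comm _ 2, pow_mul]
  norm_num
  exact h2

/-- The Littlewood–Offord inequality for linear forms some of whose coefficients may vanish. -/
lemma card_sum_mul_boolSign_eq_mul_sqrt_card_ne_zero_le {ι : Type*} [Fintype ι] [DecidableEq ι]
    (a : ι → ℝ) (b : ℝ) :
    (#{s : ι → Bool | ∑ i, a i * boolSign (s i) = b} : ℝ) * √(#{i | a i ≠ 0}) ≤
      2 ^ Fintype.card ι := by
  classical
  let p : ι → Prop := fun i => a i ≠ 0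
  let e := Equiv.piEquivPiSubtypeProd p (fun _ => Bool)
  have hcard : #{s : ι → Bool | ∑ i, a i * boolSign (s i) = b} =
      ∑ y : {i // ¬ p i} → Bool,
        #{x : {i // p i} → Bool | ∑ i : {i // p i}, a i * boolSign (x i) = b} := by
    simp only [card_filter]
    rw [← Fintype.sum_prod_type_right
      (f := fun q : ({i // p i} → Bool) × ({i // ¬ p i} → Bool) =>
        if ∑ i : {i // p i}, a i * boolSign (q.1 i) = b then 1 else 0)]
    refine Fintype.sum_equiv e _ _ fun s => ?_
    rw [← Fintype.sum_subtype_add_sum_subtype p]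
    have : ∑ i : {i // ¬ p i}, a i * boolSign (s i) = 0 :=
      sum_eq_zero fun i _ => by rw [not_not.1 i.2, zero_mul]
    rw [this, add_zero]
    rfl
  have hp : #{i | a i ≠ 0} = Fintype.card {i // p i} := (Fintype.card_subtype p).symm
  have hι : Fintype.card ι = Fintype.card {i // ¬ p i} + Fintype.card {i // p i} := by
    rw [Fintype.card_subtype_compl, Nat.sub_add_cancel (Fintype.card_subtype_le p)]
  have h := card_sum_mul_boolSign_eq_mul_sqrt_card_le (fun i : {i // p i} => a i)
    (fun i => i.2) b
  rw [hcard, hp, hι, pow_add]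
  simp only [sum_const, card_univ, Fintype.card_fun, Fintype.card_bool, smul_eq_mul,
    Nat.cast_mul, Nat.cast_pow, Nat.cast_ofNat, mul_assoc]
  gcongr

/-- Decoupled form of the quadratic Littlewood–Offord inequality. -/
lemma card_add_bilinear_eq_sq_mul_sqrt_le {α β : Type*} [Fintype α] [Fintype β]
    [DecidableEq α] [DecidableEq β] (f : (α → Bool) → ℝ) (g : (β → Bool) → ℝ)
    (d : α → β → ℝ) (hd : ∀ i j, d i j ≠ 0) (a m : ℝ) (hm : 0 < m)
    (hα : m ≤ Fintype.card α) (hβ : m ≤ Fintype.card β) :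
    (#{q : (α → Bool) × (β → Bool) |
      f q.1 + g q.2 + ∑ i, ∑ j, d i j * boolSign (q.1 i) * boolSign (q.2 j) = a} : ℝ) ^ 2 * √m ≤
      4 * (2 ^ Fintype.card α * 2 ^ Fintype.card β) ^ 2 := by
  classical
  set A : ℝ := 2 ^ Fintype.card α with hA
  set B : ℝ := 2 ^ Fintype.card β with hB
  have hA0 : 0 < A := by positivity
  have hB0 : 0 < B := by positivity
  have hk : (0 : ℝ) < Fintype.card α := hm.trans_le hα
  set k : ℝ := (Fintype.card α : ℝ) with hkdef
  let E : (α → Bool) → (β → Bool) → ℝ := fun x y =>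
    if f x + g y + ∑ i, ∑ j, d i j * boolSign (x i) * boolSign (y j) = a then 1 else 0
  let w : (β → Bool) → (β → Bool) → α → ℝ := fun y y' i =>
    ∑ j, d i j * (boolSign (y j) - boolSign (y' j))
  let L : (β → Bool) → (β → Bool) → ℝ := fun y y' =>
    #{x : α → Bool | ∑ i, w y y' i * boolSign (x i) = g y' - g y}
  let Z : (β → Bool) → (β → Bool) → ℝ := fun y y' => #{i | w y y' i = 0}
  have hcount : (#{q : (α → Bool) × (β → Bool) |
      f q.1 + g q.2 + ∑ i, ∑ j, d i j * boolSign (q.1 i) * boolSign (q.2 j) = a} : ℝ) =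
      ∑ x, ∑ y, E x y := by
    rw [card_filter, Fintype.sum_prod_type]
    push_cast
    rfl
  have hcs : (∑ x, ∑ y, E x y) ^ 2 ≤ A * ∑ x, (∑ y, E x y) ^ 2 := by
    have := sq_sum_le_card_mul_sum_sq (s := (univ : Finset (α → Bool)))
      (f := fun x => ∑ y, E x y)
    simpa [hA] using this
  have hpair : ∑ x, (∑ y, E x y) ^ 2 ≤ ∑ y, ∑ y', L y y' := by
    have h1 : ∑ x, (∑ y, E x y) ^ 2 = ∑ y, ∑ y', ∑ x, E x y * E x y' := by
      simp only [sq, sum_mul_sum]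
      rw [sum_comm]
      exact sum_congr rfl fun y _ => sum_comm
    rw [h1]
    refine sum_le_sum fun y _ => sum_le_sum fun y' _ => ?_
    simp only [L, card_filter]
    push_cast
    refine sum_le_sum fun x _ => ?_
    simp only [E]
    by_cases h1 : f x + g y + ∑ i, ∑ j, d i j * boolSign (x i) * boolSign (y j) = a
    · by_cases h2 : f x + g y' + ∑ i, ∑ j, d i j * boolSign (x i) * boolSign (y' j) = a
      · have h3 : ∑ i, w y y' i * boolSign (x i) =
            ∑ i, ∑ j, d i j * boolSign (x i) * boolSign (y j) -
              ∑ i, ∑ j, d i j * boolSign (x i) * boolSign (y' j) := by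
          simp only [w, ← sum_sub_distrib, sum_mul]
          refine sum_congr rfl fun i _ => sum_congr rfl fun j _ => ?_
          ring
        rw [if_pos h1, if_pos h2, if_pos (by rw [h3]; linarith)]
        norm_num
      · rw [if_neg h2, mul_zero]
        split_ifs <;> norm_num
    · rw [if_neg h1, zero_mul]
      split_ifs <;> norm_num
  have hL : ∀ y y', L y y' * √m ≤ 2 * A * (1 + Z y y' * √m / k) := by
    intro y y'
    have hZ0 : 0 ≤ Z y y' := Nat.cast_nonneg _
    have hL0 : 0 ≤ L y y' := Nat.cast_nonneg _
    have hsm : 0 ≤ √m := Real.sqrt_nonneg _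
    rcases le_total (k / 2) (Z y y') with h | h
    · have hLA : L y y' ≤ A := by
        have : #{x : α → Bool | ∑ i, w y y' i * boolSign (x i) = g y' - g y} ≤
            2 ^ Fintype.card α := (card_le_univ _).trans (by simp)
        simp only [L, hA]
        exact_mod_cast this
      have h1 : 1 ≤ 2 * (Z y y' / k) := by
        rw [← mul_div_assoc, le_div_iff₀ hk]
        linarith
      calc L y y' * √m ≤ A * √m := by gcongr
        _ ≤ A * √m * (2 * (Z y y' / k)) := le_mul_of_one_le_right (by positivity) h1
        _ = 2 * A * (Z y y' * √m / k) := by ring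
        _ ≤ _ := by gcongr; linarith
    · have hT : Z y y' + (#{i | w y y' i ≠ 0} : ℝ) = k := by
        have := card_filter_add_card_filter_not (s := (univ : Finset α)) (fun i => w y y' i = 0)
        rw [card_univ] at this
        simp only [Z, hkdef]
        exact_mod_cast this
      have hlo := card_sum_mul_boolSign_eq_mul_sqrt_card_ne_zero_le (w y y') (g y' - g y)
      have hs : √m ≤ 2 * √(#{i | w y y' i ≠ 0} : ℝ) := by
        rw [show (2 : ℝ) = √4 by rw [show (4 : ℝ) = 2 ^ 2 by norm_num]; simp,
          ← Real.sqrt_mul (by norm_num)]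
        refine Real.sqrt_le_sqrt ?_
        linarith
      calc L y y' * √m ≤ L y y' * (2 * √(#{i | w y y' i ≠ 0} : ℝ)) := by gcongr
        _ = 2 * (L y y' * √(#{i | w y y' i ≠ 0} : ℝ)) := by ring
        _ ≤ 2 * A := by gcongr
        _ ≤ _ := le_mul_of_one_le_right (by positivity) (by
          have : 0 ≤ Z y y' * √m / k := by positivity
          linarith)
  have hZ : (∑ y, ∑ y', Z y y') * √m ≤ k * B ^ 2 := by
    have h1 : ∑ y, ∑ y', Z y y' =
        ∑ i, ∑ y', (#{y : β → Bool | w y y' i = 0} : ℝ) := by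
      simp only [Z, card_filter]
      push_cast
      calc _ = ∑ y', ∑ y, ∑ i, (if w y y' i = 0 then (1 : ℝ) else 0) := sum_comm
        _ = ∑ y', ∑ i, ∑ y, (if w y y' i = 0 then (1 : ℝ) else 0) :=
          sum_congr rfl fun _ _ => sum_comm
        _ = _ := sum_comm
    have h2 : ∀ i y', (#{y : β → Bool | w y y' i = 0} : ℝ) * √m ≤ B := by
      intro i y'
      have hlo := card_sum_mul_boolSign_eq_mul_sqrt_card_le (d i) (hd i)
        (∑ j, d i j * boolSign (y' j))
      have h3 : ∀ y, w y y' i = 0 ↔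
          ∑ j, d i j * boolSign (y j) = ∑ j, d i j * boolSign (y' j) := by
        intro y
        simp only [w, mul_sub, sum_sub_distrib, sub_eq_zero]
      simp only [h3]
      refine le_trans ?_ hlo
      gcongr
    rw [h1, sum_mul]
    calc _ ≤ ∑ i : α, ∑ y' : β → Bool, B := by
          refine sum_le_sum fun i _ => ?_
          rw [sum_mul]
          exact sum_le_sum fun y' _ => h2 i y'
      _ = k * B ^ 2 := by
          simp only [sum_const, card_univ, Fintype.card_fun, Fintype.card_bool, nsmul_eq_mul,
            Nat.cast_pow, Nat.cast_ofNat, hkdef, hB]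
          ring
  have htotal : (∑ y, ∑ y', L y y') * √m ≤ 4 * A * B ^ 2 := by
    calc (∑ y, ∑ y', L y y') * √m = ∑ y, ∑ y', L y y' * √m := by simp only [sum_mul]
      _ ≤ ∑ y, ∑ y', 2 * A * (1 + Z y y' * √m / k) :=
        sum_le_sum fun y _ => sum_le_sum fun y' _ => hL y y'
      _ = 2 * A * (B ^ 2 + (∑ y, ∑ y', Z y y') * √m / k) := by
        simp only [← mul_sum, sum_add_distrib, sum_mul, sum_div]
        congr 2
        simp [hB]
        ring
      _ ≤ 2 * A * (B ^ 2 + k * B ^ 2 / k) := by gcongr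
      _ = 4 * A * B ^ 2 := by
        field_simp
        ring
  rw [hcount]
  calc (∑ x, ∑ y, E x y) ^ 2 * √m ≤ A * (∑ y, ∑ y', L y y') * √m := by
        gcongr
        exact hcs.trans (by gcongr)
    _ = A * ((∑ y, ∑ y', L y y') * √m) := by ring
    _ ≤ A * (4 * A * B ^ 2) := by gcongr
    _ = 4 * (A * B) ^ 2 := by ring

/-- Quadratic Littlewood–Offord inequality for a form whose coefficients across a given cut of the
variables do not vanish. -/
lemma card_quadratic_eq_sq_mul_sqrt_le {ι : Type*} [Fintype ι] [DecidableEq ι] (p : ι → Prop)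
    [DecidablePred p] (c : ι → ι → ℝ) (hc : ∀ i j, p i → ¬ p j → c i j + c j i ≠ 0)
    (a m : ℝ) (hm : 0 < m) (hp : m ≤ Fintype.card {i // p i})
    (hnp : m ≤ Fintype.card {i // ¬ p i}) :
    (#{s : ι → Bool | ∑ i, ∑ j, c i j * boolSign (s i) * boolSign (s j) = a} : ℝ) ^ 2 * √m ≤
      4 * (2 ^ Fintype.card ι) ^ 2 := by
  classical
  let e := Equiv.piEquivPiSubtypeProd p (fun _ => Bool)
  have hι : Fintype.card ι = Fintype.card {i // p i} + Fintype.card {i // ¬ p i} := by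
    rw [Fintype.card_subtype_compl, Nat.add_sub_cancel' (Fintype.card_subtype_le p)]
  have h := card_add_bilinear_eq_sq_mul_sqrt_le
    (fun x : {i // p i} → Bool =>
      ∑ i : {i // p i}, ∑ j : {i // p i}, c i j * boolSign (x i) * boolSign (x j))
    (fun y : {i // ¬ p i} → Bool =>
      ∑ i : {i // ¬ p i}, ∑ j : {i // ¬ p i}, c i j * boolSign (y i) * boolSign (y j))
    (fun i j => c i j + c j i) (fun i j => hc i j i.2 j.2) a m hm hp hnp
  rw [hι, pow_add]
  convert h using 4
  refine card_equiv e fun s => ?_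
  simp only [mem_filter, mem_univ, true_and]
  refine Eq.congr_left ?_
  have hsplit : ∀ u : ι → ℝ, ∑ i, u i = ∑ i : {i // p i}, u i + ∑ i : {i // ¬ p i}, u i :=
    fun u => (Fintype.sum_subtype_add_sum_subtype p u).symm
  have hcross : ∑ i : {i // p i}, ∑ j : {i // ¬ p i},
      (c i j + c j i) * boolSign (s i) * boolSign (s j) =
      ∑ i : {i // p i}, ∑ j : {i // ¬ p i}, c i j * boolSign (s i) * boolSign (s j) +
      ∑ i : {i // ¬ p i}, ∑ j : {i // p i}, c i j * boolSign (s i) * boolSign (s j) := by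
    rw [sum_comm (s := (univ : Finset {i // ¬ p i}))]
    simp only [← sum_add_distrib]
    refine sum_congr rfl fun i _ => sum_congr rfl fun j _ => ?_
    ring
  change _ = ∑ i : {i // p i}, ∑ j : {i // p i}, c i j * boolSign (s i) * boolSign (s j) +
      ∑ i : {i // ¬ p i}, ∑ j : {i // ¬ p i}, c i j * boolSign (s i) * boolSign (s j) +
      ∑ i : {i // p i}, ∑ j : {i // ¬ p i}, (c i j + c j i) * boolSign (s i) * boolSign (s j)
  rw [hcross]
  simp only [hsplit, sum_add_distrib]
  ring

/-- **Quadratic Littlewood–Offord inequality** (Costello–Tao–Vu). There is an absolute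
constant `C > 0` such that for every `n ≥ 1`, if `c i j` are nonzero reals for `i ≤ j`
and `ξ i` are i.i.d. uniform `±1` signs (modeled by a uniform `s : Fin n → Bool`, with
`ξ i = 1` if `s i = true` and `ξ i = -1` otherwise), then for the quadratic form
`F = ∑_{i ≤ j} c i j * ξ i * ξ j` and every real `a`, `ℙ(F = a) ≤ C * n ^ (-1/8)`. -/
theorem quadratic_littlewood_offord : ∃ C : ℝ, 0 < C ∧ ∀ n : ℕ, 1 ≤ n →
    ∀ c : Fin n → Fin n → ℝ, (∀ i j : Fin n, i ≤ j → c i j ≠ 0) → ∀ a : ℝ,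
      (Nat.card {s : Fin n → Bool //
          ∑ p ∈ Finset.univ.filter (fun p : Fin n × Fin n => p.1 ≤ p.2),
            c p.1 p.2 * (if s p.1 then (1 : ℝ) else -1) * (if s p.2 then (1 : ℝ) else -1)
              = a} : ℝ) / 2 ^ n ≤
        C * (n : ℝ) ^ (-(1 : ℝ) / 8) := by
  classical
  refine ⟨3, by norm_num, fun n hn c hc a => ?_⟩
  let c' : Fin n → Fin n → ℝ := fun i j => if i ≤ j then c i j else 0
  have hcard : Nat.card {s : Fin n → Bool //
      ∑ p ∈ Finset.univ.filter (fun p : Fin n × Fin n => p.1 ≤ p.2),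
        c p.1 p.2 * (if s p.1 then (1 : ℝ) else -1) * (if s p.2 then (1 : ℝ) else -1) = a} =
      #{s : Fin n → Bool | ∑ i, ∑ j, c' i j * boolSign (s i) * boolSign (s j) = a} := by
    rw [Nat.card_eq_fintype_card, Fintype.card_subtype]
    congr 1
    refine filter_congr fun s _ => Eq.congr_left ?_
    rw [sum_filter, Fintype.sum_prod_type]
    refine sum_congr rfl fun i _ => sum_congr rfl fun j _ => ?_
    by_cases h : i ≤ j <;> simp [c', h, boolSign]
  rw [hcard]
  set N : ℝ :=
    (#{s : Fin n → Bool | ∑ i, ∑ j, c' i j * boolSign (s i) * boolSign (s j) = a} : ℝ)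
    with hN
  have hn0 : (1 : ℝ) ≤ n := by exact_mod_cast hn
  rw [div_le_iff₀ (by positivity)]
  rcases hn.eq_or_lt with rfl | hn2
  · have : #{s : Fin 1 → Bool | ∑ i, ∑ j, c' i j * boolSign (s i) * boolSign (s j) = a} ≤ 2 :=
      (card_le_univ _).trans (by simp)
    have h2 : N ≤ 2 := by rw [hN]; exact_mod_cast this
    norm_num
    linarith
  have hp : Fintype.card {i : Fin n // i.val < n / 2} = n / 2 := by
    rw [Fintype.card_subtype, Fin.card_filter_val_lt]
    omega
  have hnp : Fintype.card {i : Fin n // ¬ i.val < n / 2} = n - n / 2 := by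
    rw [Fintype.card_subtype_compl, hp, Fintype.card_fin]
  have hmain := card_quadratic_eq_sq_mul_sqrt_le (fun i : Fin n => i.val < n / 2) c' (by
      intro i j hi hj
      have hij : i < j := Fin.lt_def.2 (by omega)
      simpa [c', hij.le, not_le.2 hij] using hc i j hij.le) a ((n : ℝ) / 3) (by positivity)
    (by
      rw [hp, div_le_iff₀ (by norm_num)]
      have : n ≤ n / 2 * 3 := by omega
      exact_mod_cast this)
    (by
      rw [hnp, div_le_iff₀ (by norm_num)]
      have : n ≤ (n - n / 2) * 3 := by omega
      exact_mod_cast this)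
  rw [← hN, Fintype.card_fin] at hmain
  refine abs_le_of_sq_le_sq' ?_ (by positivity) |>.2
  have hsn : √(n : ℝ) ≤ 2 * √((n : ℝ) / 3) := by
    rw [show (2 : ℝ) = √4 by rw [show (4 : ℝ) = 2 ^ 2 by norm_num]; simp,
      ← Real.sqrt_mul (by norm_num)]
    refine Real.sqrt_le_sqrt ?_
    linarith
  have hNn : N ^ 2 * √(n : ℝ) ≤ 9 * (2 ^ n) ^ 2 := by
    have := mul_le_mul_of_nonneg_left hsn (sq_nonneg N)
    have h0 : (0 : ℝ) ≤ (2 ^ n) ^ 2 := by positivity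
    linarith
  have hpow : (√(n : ℝ))⁻¹ ≤ ((n : ℝ) ^ (-(1 : ℝ) / 8)) ^ 2 := by
    rw [Real.sqrt_eq_rpow, ← Real.rpow_neg (by positivity), ← Real.rpow_natCast,
      ← Real.rpow_mul (by positivity)]
    exact Real.rpow_le_rpow_of_exponent_le hn0 (by norm_num)
  have hs0 : 0 < √(n : ℝ) := Real.sqrt_pos.2 (by positivity)
  calc N ^ 2 ≤ 9 * (2 ^ n) ^ 2 * (√(n : ℝ))⁻¹ := by
        rw [← div_eq_mul_inv, le_div_iff₀ hs0]
        exact hNn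
    _ ≤ 9 * (2 ^ n) ^ 2 * ((n : ℝ) ^ (-(1 : ℝ) / 8)) ^ 2 := by gcongr
    _ = _ := by ring
end

section
/- For every pair of constants $A > 0$ and $\alpha > 0$ there exist constants $d$ and $B$ (depending only on $A$ and $\alpha$) such that the following holds for all sufficiently large $n$: if $\mathbf{v} = \{v_1, \dots, v_n\}$ is a multiset of $n$ integers such that $\mathbb{P}(\sum_{i=1}^n \xi_i v_i = 0) \geq n^{-A}$, where the $\xi_i$ are i.i.d. random variables taking values $+1$ and $-1$ each with probability $1/2$, then there is a generalized arithmetic progression $Q$ of rank at most $d$ and volume at most $n^B$ that contains all but at most $n^{\alpha}$ of the elements $v_1, \dots, v_n$ (counting multiplicity). -/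
/-- The integers `∑ tᵢ wᵢ` with `|tᵢ| < sᵢ`, where `(wᵢ, sᵢ)` runs over the list. -/
def boxSums : List (ℤ × ℕ) → Set ℤ
  | [] => {0}
  | p :: L => {y | ∃ x ∈ boxSums L, ∃ t : ℤ, |t| < p.2 ∧ y = x + t * p.1}

/-- Each new generator `w`, of order `s ≤ k`, has no multiple `t w` with `0 < t < s` among the box
sums of the earlier ones, and either `s = k` or `s w` is such a box sum. -/
def Admissible (k : ℕ) : List (ℤ × ℕ) → Prop
  | [] => True
  | p :: L => 2 ≤ p.2 ∧ p.2 ≤ k ∧ (∀ t : ℕ, 0 < t → t < p.2 → (t : ℤ) * p.1 ∉ boxSums L) ∧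
      (p.2 = k ∨ (p.2 : ℤ) * p.1 ∈ boxSums L) ∧ Admissible k L

/-- The product of the orders. -/
def orderProd (L : List (ℤ × ℕ)) : ℕ := (L.map Prod.snd).prod

theorem neg_mem_boxSums {L : List (ℤ × ℕ)} {y : ℤ} (h : y ∈ boxSums L) : -y ∈ boxSums L := by
  induction L generalizing y with
  | nil => simp_all [boxSums]
  | cons p L ih =>
    obtain ⟨x, hx, t, ht, rfl⟩ := h
    exact ⟨-x, ih hx, -t, by simpa using ht, by ring⟩

theorem two_pow_length_le_orderProd {k : ℕ} {L : List (ℤ × ℕ)} (h : Admissible k L) :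
    2 ^ L.length ≤ orderProd L := by
  induction L with
  | nil => simp [orderProd]
  | cons p L ih =>
    obtain ⟨h2, -, -, -, hL⟩ := h
    have := Nat.mul_le_mul h2 (ih hL)
    simpa [orderProd, pow_succ, mul_comm] using this

theorem exists_rational_coordinates {k : ℕ} {L : List (ℤ × ℕ)} (h : Admissible k L) :
    ∃ r : ℕ, k ^ r ≤ orderProd L ∧ ∃ w : Fin r → ℤ, ∀ y ∈ boxSums L, ∃ z : Fin r → ℤ,
      (∀ i, |z i| ≤ k * (orderProd L : ℤ) ^ 2) ∧ (orderProd L : ℤ) * y = ∑ i, z i * w i := by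
  induction L with
  | nil =>
    refine ⟨0, by simp [orderProd], Fin.elim0, fun y hy => ⟨Fin.elim0, fun i => i.elim0, ?_⟩⟩
    simp_all [boxSums]
  | cons p L ih =>
    have hpos := (pow_pos two_pos _).trans_le (two_pow_length_le_orderProd h.2.2.2.2)
    obtain ⟨h2, hk, -, hs, hL⟩ := h
    obtain ⟨r, hr, w, hw⟩ := ih hL
    obtain ⟨a, s⟩ := p
    simp only at h2 hk hs
    have hP : orderProd ((a, s) :: L) = s * orderProd L := by simp [orderProd]
    rw [hP]
    generalize orderProd L = P at *
    have hs2 : (2 : ℤ) ≤ s := by exact_mod_cast h2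
    have hP1 : (1 : ℤ) ≤ P := by exact_mod_cast hpos
    have hk2 : (s : ℤ) ≤ k := by exact_mod_cast hk
    push_cast
    rcases hs with rfl | hs
    · refine ⟨r + 1, by rw [pow_succ, mul_comm]; gcongr, Fin.cons a w, ?_⟩
      rintro y ⟨x, hx, t, ht, rfl⟩
      obtain ⟨z, hz, hzx⟩ := hw x hx
      simp only at ht ⊢
      refine ⟨Fin.cons (s * P * t) (fun i => s * z i), ?_, ?_⟩
      · intro i
        refine Fin.cases ?_ (fun i => ?_) i
        · simp only [Fin.cons_zero, abs_mul, Nat.abs_cast]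
          calc (s : ℤ) * P * |t| ≤ s * P * s := by gcongr
            _ = s * (s * P) * 1 := by ring
            _ ≤ s * (s * P) * (s * P) := by gcongr; nlinarith
            _ = _ := by ring
        · simp only [Fin.cons_succ, abs_mul, Nat.abs_cast]
          calc (s : ℤ) * |z i| ≤ s * (s * P ^ 2) := by gcongr; exact hz i
            _ = s * (1 * (s * P ^ 2)) := by ring
            _ ≤ s * (s * (s * P ^ 2)) := by gcongr; linarith
            _ = _ := by ring
      · simp only [Fin.sum_univ_succ, Fin.cons_zero, Fin.cons_succ, mul_assoc, ← Finset.mul_sum,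
          ← hzx]
        ring
    · refine ⟨r, hr.trans (by nlinarith), w, ?_⟩
      rintro y ⟨x, hx, t, ht, rfl⟩
      obtain ⟨z, hz, hzx⟩ := hw x hx
      obtain ⟨z', hz', hzx'⟩ := hw _ hs
      simp only at ht ⊢
      refine ⟨fun i => s * z i + t * z' i, fun i => ?_, ?_⟩
      · calc |(s : ℤ) * z i + t * z' i| ≤ s * |z i| + |t| * |z' i| := by
              simpa [abs_mul] using abs_add_le ((s : ℤ) * z i) (t * z' i)
          _ ≤ s * (k * P ^ 2) + s * (k * P ^ 2) := by gcongr <;> first | exact hz i | exact hz' i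
          _ = 2 * (s * (k * P ^ 2)) := by ring
          _ ≤ s * (s * (k * P ^ 2)) := by gcongr
          _ = _ := by ring
      · simp only [add_mul, mul_assoc, Finset.sum_add_distrib, ← Finset.mul_sum, ← hzx, ← hzx']
        ring

theorem exists_integral_generators (P : ℕ) (hP : 0 < P) (r : ℕ) (w : Fin r → ℤ) :
    ∃ a : Fin r → ℤ, ∀ (M : ℤ) (z : Fin r → ℤ), (∀ i, |z i| ≤ M) → (P : ℤ) ∣ ∑ i, z i * w i →
      ∃ t : Fin r → ℤ, (∀ i, |t i| ≤ M * P ^ r) ∧ ∑ i, z i * w i = P * ∑ i, t i * a i := by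
  induction r with
  | zero => exact ⟨Fin.elim0, fun M z _ _ => ⟨Fin.elim0, fun i => i.elim0, by simp⟩⟩
  | succ r ih =>
    obtain ⟨a, ha⟩ := ih (fun i => w i.succ)
    have hP1 : (1 : ℤ) ≤ P := by exact_mod_cast hP
    let lifts : ℤ → Prop := fun h =>
      ∃ l : Fin r → ℤ, (P : ℤ) ∣ h * w 0 + ∑ i, l i * w i.succ
    have hex : ∃ h : ℕ, 0 < h ∧ lifts h := ⟨P, hP, 0, by simp⟩
    classical
    obtain ⟨h0, l, hl⟩ := Nat.find_spec hex
    have hmin : ∀ h : ℕ, 0 < h → lifts h → Nat.find hex ≤ h := fun h h1 h2 =>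
      Nat.find_min' hex ⟨h1, h2⟩
    generalize Nat.find hex = h at *
    have hl' : (P : ℤ) ∣ h * w 0 + ∑ i, (l i % P) * w i.succ := by
      have : (h : ℤ) * w 0 + ∑ i, (l i % P) * w i.succ =
          h * w 0 + ∑ i, l i * w i.succ - P * ∑ i, (l i / P) * w i.succ := by
        rw [Finset.mul_sum, add_sub_assoc, ← Finset.sum_sub_distrib]
        congr 1
        refine Finset.sum_congr rfl fun i _ => ?_
        rw [Int.emod_def]; ring
      rw [this]
      exact dvd_sub hl (dvd_mul_right _ _)
    obtain ⟨a₀, ha₀⟩ := hl'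
    refine ⟨Fin.cons a₀ a, fun M z hz hdvd => ?_⟩
    have hM : 0 ≤ M := (abs_nonneg _).trans (hz 0)
    have hh : (0 : ℤ) < h := by exact_mod_cast h0
    have hz0 : (h : ℤ) ∣ z 0 := by
      refine Int.dvd_of_emod_eq_zero ?_
      by_contra hne
      have hnn := Int.emod_nonneg (z 0) hh.ne'
      have hlt := Int.emod_lt_of_pos (z 0) hh
      have := hmin (z 0 % h).toNat (by omega) (by
        refine ⟨fun i => z i.succ - (z 0 / h) * l i, ?_⟩
        rw [Int.toNat_of_nonneg hnn]
        rw [Fin.sum_univ_succ] at hdvd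
        have hsub := dvd_sub hdvd (hl.mul_left (z 0 / h))
        have heq : z 0 % h * w 0 + ∑ i : Fin r, (z i.succ - z 0 / h * l i) * w i.succ =
            z 0 * w 0 + ∑ i : Fin r, z i.succ * w i.succ -
              z 0 / h * (h * w 0 + ∑ i, l i * w i.succ) := by
          simp only [sub_mul, Finset.sum_sub_distrib, mul_assoc, ← Finset.mul_sum]
          rw [Int.emod_def]; ring
        rwa [heq])
      omega
    obtain ⟨t, ht⟩ := hz0
    have htM : |t| ≤ M := by
      have := hz 0
      rw [ht, abs_mul, Nat.abs_cast] at this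
      nlinarith [abs_nonneg t]
    have key : ∑ i, z i * w i - P * (t * a₀) =
        ∑ i : Fin r, (z i.succ - t * (l i % P)) * w i.succ := by
      rw [Fin.sum_univ_succ, ht, mul_left_comm, ← ha₀]
      simp only [sub_mul, Finset.sum_sub_distrib, mul_assoc, ← Finset.mul_sum]
      ring
    obtain ⟨u, hu, hsum⟩ := ha (M * P) (fun i => z i.succ - t * (l i % P)) (fun i => by
      have h1 := Int.emod_nonneg (l i) (by omega : (P : ℤ) ≠ 0)
      have h2 := Int.emod_lt_of_pos (l i) (by omega : (0 : ℤ) < P)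
      calc |z i.succ - t * (l i % P)| ≤ |z i.succ| + |t| * |l i % P| := by
            rw [← abs_mul]; exact abs_sub _ _
        _ ≤ M + M * (P - 1) := by
            gcongr
            · exact hz _
            · rw [abs_of_nonneg h1]; omega
        _ = M * P := by ring) (by
      rw [← key]
      exact dvd_sub hdvd (dvd_mul_right _ _))
    refine ⟨Fin.cons t u, fun i => ?_, ?_⟩
    · refine Fin.cases ?_ (fun i => ?_) i
      · rw [Fin.cons_zero]
        exact htM.trans (le_mul_of_one_le_right hM (one_le_pow₀ hP1))
      · rw [Fin.cons_succ, pow_succ', ← mul_assoc]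
        exact hu i
    · have hcons : ∑ i, (Fin.cons t u : Fin (r + 1) → ℤ) i * (Fin.cons a₀ a : Fin (r + 1) → ℤ) i =
          t * a₀ + ∑ i, u i * a i := by
        simp [Fin.sum_univ_succ]
      rw [hcons, mul_add, ← hsum, ← key]
      ring

theorem integral_exp_int_mul (y : ℤ) :
    ∫ x in (0 : ℝ)..2 * Real.pi, Complex.exp (y * x * Complex.I) =
      if y = 0 then (2 * Real.pi : ℂ) else 0 := by
  split_ifs with h
  · simp [h]
  · have hc : (y * Complex.I : ℂ) ≠ 0 := by simp [h]
    have := integral_exp_mul_complex (a := 0) (b := 2 * Real.pi) hc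
    have h2 : ∀ x : ℝ, (y * x * Complex.I : ℂ) = y * Complex.I * x := fun x => by ring
    simp only [h2]
    rw [this]
    have h3 : (y * Complex.I * ((2 * Real.pi : ℝ) : ℂ)) = y * (2 * Real.pi * Complex.I) := by
      push_cast; ring
    rw [h3, Complex.exp_int_mul_two_pi_mul_I]
    simp

theorem integral_prod_cos {n : ℕ} (v : Fin n → ℤ) :
    ∫ x in (0 : ℝ)..2 * Real.pi, ∏ i, Real.cos (v i * x) =
      2 * Real.pi *
        ((Nat.card {s : Fin n → Bool // ∑ i, (if s i then v i else -v i) = 0} : ℝ) / 2 ^ n) := by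
  have hexp : ∀ x : ℝ, ((∏ i, Real.cos (v i * x) : ℝ) : ℂ) =
      ∑ s : Fin n → Bool, (1 / 2 ^ n : ℂ) *
        Complex.exp ((∑ i, (if s i then v i else -v i) : ℤ) * x * Complex.I) := by
    intro x
    have : ∀ i, ((Real.cos (v i * x) : ℝ) : ℂ) = ∑ b : Bool,
        (1 / 2 : ℂ) * Complex.exp ((if b then v i else -v i : ℤ) * x * Complex.I) := by
      intro i
      rw [Complex.ofReal_cos, Complex.cos, Fintype.sum_bool]
      push_cast
      simp only [if_true]
      ring_nf
    rw [Complex.ofReal_prod]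
    simp only [this]
    rw [Finset.prod_univ_sum, Fintype.piFinset_univ]
    refine Finset.sum_congr rfl fun s _ => ?_
    rw [Finset.prod_mul_distrib, ← Complex.exp_sum, Finset.prod_const, Finset.card_univ,
      Fintype.card_fin, ← Finset.sum_mul, ← Finset.sum_mul]
    push_cast
    simp
  apply Complex.ofReal_injective
  rw [← intervalIntegral.integral_ofReal]
  simp only [hexp]
  rw [intervalIntegral.integral_finsetSum
    (fun s _ => (by fun_prop : Continuous _).intervalIntegrable _ _)]
  simp only [intervalIntegral.integral_const_mul, integral_exp_int_mul]
  rw [← Finset.mul_sum, Finset.sum_ite, Finset.sum_const_zero, add_zero, Finset.sum_const,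
    ← Fintype.card_subtype, Nat.card_eq_fintype_card]
  push_cast
  rw [nsmul_eq_mul]
  ring

/-- The trigonometric product attached to a list of generators and orders. -/
noncomputable def cosProd (L : List (ℤ × ℕ)) (x : ℝ) : ℝ :=
  (L.map fun p => Real.cos (p.1 * x) ^ (2 * (p.2 - 1))).prod

theorem cosProd_cons (p : ℤ × ℕ) (L : List (ℤ × ℕ)) (x : ℝ) :
    cosProd (p :: L) x = Real.cos (p.1 * x) ^ (2 * (p.2 - 1)) * cosProd L x := by
  simp [cosProd]

theorem continuous_cosProd (L : List (ℤ × ℕ)) : Continuous (cosProd L) := by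
  induction L with
  | nil => exact continuous_const
  | cons p L ih => simp only [funext (cosProd_cons p L)]; fun_prop

theorem cos_pow_mul_exp (w y : ℤ) (q : ℕ) (x : ℝ) :
    ((Real.cos (w * x) ^ (2 * q) : ℝ) : ℂ) * Complex.exp (y * x * Complex.I) =
      ∑ j ∈ Finset.range (2 * q + 1), ((2 * q).choose j / 4 ^ q : ℂ) *
        Complex.exp ((y + 2 * ((j - q : ℤ) * w) : ℤ) * x * Complex.I) := by
  rw [Complex.ofReal_pow, Complex.ofReal_cos, Complex.cos, div_pow, add_pow,
    Finset.sum_div, Finset.sum_mul]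
  refine Finset.sum_congr rfl fun j hj => ?_
  have hj' : j ≤ 2 * q := by simpa [Nat.lt_succ_iff] using hj
  rw [← Complex.exp_nat_mul, ← Complex.exp_nat_mul, ← Complex.exp_add, pow_mul, Nat.cast_sub hj']
  rw [mul_comm (Complex.exp _) (_ : ℂ), mul_div_right_comm, mul_assoc, ← Complex.exp_add]
  norm_num
  left
  congr 1
  ring

theorem integral_cosProd_cons (p : ℤ × ℕ) (L : List (ℤ × ℕ)) (y : ℤ) :
    ∫ x in (0 : ℝ)..2 * Real.pi, (cosProd (p :: L) x : ℂ) * Complex.exp (y * x * Complex.I) =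
      ∑ j ∈ Finset.range (2 * (p.2 - 1) + 1),
        ((2 * (p.2 - 1)).choose j / 4 ^ (p.2 - 1) : ℂ) *
        ∫ x in (0 : ℝ)..2 * Real.pi, (cosProd L x : ℂ) *
          Complex.exp ((y + 2 * ((j - (p.2 - 1 : ℕ) : ℤ) * p.1) : ℤ) * x * Complex.I) := by
  have hc := continuous_cosProd L
  simp only [← intervalIntegral.integral_const_mul]
  rw [← intervalIntegral.integral_finsetSum
    (fun s _ => (by fun_prop : Continuous _).intervalIntegrable _ _)]
  refine intervalIntegral.integral_congr fun x _ => ?_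
  rw [cosProd_cons, Complex.ofReal_mul, mul_right_comm, cos_pow_mul_exp, Finset.sum_mul]
  refine Finset.sum_congr rfl fun j _ => ?_
  ring

theorem integral_cosProd_mul_exp_eq_zero {k : ℕ} {L : List (ℤ × ℕ)} (h : Admissible k L) {y : ℤ}
    (hy : ∀ z ∈ boxSums L, y ≠ 2 * z) :
    ∫ x in (0 : ℝ)..2 * Real.pi, (cosProd L x : ℂ) * Complex.exp (y * x * Complex.I) = 0 := by
  induction L generalizing y with
  | nil =>
    have : y ≠ 0 := by simpa [boxSums] using hy
    simp [cosProd, integral_exp_int_mul, this]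
  | cons p L ih =>
    rw [integral_cosProd_cons]
    refine Finset.sum_eq_zero fun j hj => ?_
    rw [ih h.2.2.2.2, mul_zero]
    intro z hz hyz
    have hj' : j < 2 * (p.2 - 1) + 1 := by simpa using hj
    have := h.1
    refine hy (z + -(j - (p.2 - 1 : ℕ) : ℤ) * p.1) ⟨z, hz, _, ?_, rfl⟩ ?_
    · rw [abs_lt]; omega
    · linear_combination hyz

theorem centralBinom_div_four_pow_le (q : ℕ) :
    (q.centralBinom / 4 ^ q : ℝ) ^ 2 * (2 * q + 1) ≤ 1 := by
  induction q with
  | zero => simp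
  | succ q ih =>
    have h := Nat.succ_mul_centralBinom_succ q
    have h' : ((q + 1 : ℝ)) * (q + 1).centralBinom = 2 * (2 * q + 1) * q.centralBinom := by
      exact_mod_cast h
    have h2 : ((q + 1).centralBinom : ℝ) = 2 * (2 * q + 1) * q.centralBinom / (q + 1) := by
      field_simp; linarith
    rw [h2]
    push_cast
    calc (2 * (2 * q + 1) * q.centralBinom / (q + 1) / 4 ^ (q + 1) : ℝ) ^ 2 * (2 * (q + 1) + 1)
        = ((q.centralBinom / 4 ^ q : ℝ) ^ 2 * (2 * q + 1)) *
          ((2 * q + 1) * (2 * q + 3) / (2 * q + 2) ^ 2) := by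
          field_simp; ring
      _ ≤ 1 * 1 := by
          gcongr
          rw [div_le_one (by positivity)]
          nlinarith
      _ = 1 := by ring

theorem integral_cosProd_nonneg_and_sq_mul_le {k : ℕ} {L : List (ℤ × ℕ)} (h : Admissible k L) :
    0 ≤ ∫ x in (0 : ℝ)..2 * Real.pi, cosProd L x ∧
    (∫ x in (0 : ℝ)..2 * Real.pi, cosProd L x) ^ 2 * orderProd L ≤ (2 * Real.pi) ^ 2 := by
  induction L with
  | nil => simp [cosProd, orderProd, Real.pi_pos.le]
  | cons p L ih =>
    obtain ⟨h2, hk, hnot, -, hL⟩ := h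
    have hrec : ∫ x in (0 : ℝ)..2 * Real.pi, cosProd (p :: L) x =
        ((p.2 - 1).centralBinom / 4 ^ (p.2 - 1)) * ∫ x in (0 : ℝ)..2 * Real.pi, cosProd L x := by
      apply Complex.ofReal_injective
      have := integral_cosProd_cons p L 0
      rw [Finset.sum_eq_single (p.2 - 1)] at this
      · simpa [Nat.centralBinom, intervalIntegral.integral_ofReal] using this
      · intro j hj hne
        rw [integral_cosProd_mul_exp_eq_zero hL, mul_zero]
        intro z hz hyz
        have hj' : j < 2 * (p.2 - 1) + 1 := by simpa using hj
        have hz' : (j - (p.2 - 1 : ℕ) : ℤ) * p.1 = z := by linarith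
        rcases lt_or_gt_of_ne hne with hlt | hlt
        · refine hnot (p.2 - 1 - j) (by omega) (by omega) ?_
          rw [Nat.cast_sub hlt.le]
          convert neg_mem_boxSums hz using 1
          rw [← hz']; ring
        · refine hnot (j - (p.2 - 1)) (by omega) (by omega) ?_
          rw [Nat.cast_sub hlt.le, hz']
          exact hz
      · intro hn
        simp at hn
        omega
    obtain ⟨ih0, ih1⟩ := ih hL
    rw [hrec]
    refine ⟨by positivity, ?_⟩
    have hs : orderProd (p :: L) = p.2 * orderProd L := by simp [orderProd]
    have hq : (p.2 : ℝ) = (p.2 - 1 : ℕ) + 1 := by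
      rw [Nat.cast_sub (by omega)]; simp
    rw [hs, Nat.cast_mul, hq]
    set I := ∫ x in (0 : ℝ)..2 * Real.pi, cosProd L x
    set q := p.2 - 1
    calc ((q.centralBinom / 4 ^ q : ℝ) * I) ^ 2 * ((q + 1) * orderProd L)
        = ((q.centralBinom / 4 ^ q : ℝ) ^ 2 * (q + 1)) * (I ^ 2 * orderProd L) := by ring
      _ ≤ 1 * (2 * Real.pi) ^ 2 := by
          gcongr
          refine le_trans ?_ (centralBinom_div_four_pow_le q)
          gcongr
          linarith [(Nat.cast_nonneg q : (0 : ℝ) ≤ q)]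
      _ = _ := one_mul _

theorem prod_le_sum_pow_card_div {ι : Type*} (T : Finset ι) (hT : T.Nonempty) (c : ι → ℝ)
    (hc : ∀ j ∈ T, 0 ≤ c j) : ∏ j ∈ T, c j ≤ ∑ j ∈ T, (T.card : ℝ)⁻¹ * c j ^ T.card := by
  have hcard : T.card ≠ 0 := hT.card_pos.ne'
  have := Real.geom_mean_le_arith_mean_weighted T (fun _ => (T.card : ℝ)⁻¹)
    (fun j => c j ^ T.card) (fun _ _ => by positivity) (by simp [hcard])
    (fun j hj => pow_nonneg (hc j hj) _)
  refine le_of_eq_of_le (Finset.prod_congr rfl fun j hj => ?_) this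
  exact (Real.pow_rpow_inv_natCast (hc j hj) hcard).symm

theorem exists_integral_mul_prod_le {ι : Type*} (T : Finset ι) (hT : T.Nonempty) (F : ℝ → ℝ)
    (c : ι → ℝ → ℝ) (hF : Continuous F) (hc : ∀ j, Continuous (c j)) (hF0 : ∀ x, 0 ≤ F x)
    (hc0 : ∀ j x, 0 ≤ c j x) {a b : ℝ} (hab : a ≤ b) :
    ∃ j ∈ T, ∫ x in a..b, F x * ∏ j ∈ T, c j x ≤ ∫ x in a..b, F x * c j x ^ T.card := by
  by_contra! hlt
  have hcard : (0 : ℝ) < T.card := by exact_mod_cast hT.card_pos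
  have h1 : ∫ x in a..b, F x * ∏ j ∈ T, c j x ≤
      ∫ x in a..b, ∑ j ∈ T, (T.card : ℝ)⁻¹ * (F x * c j x ^ T.card) := by
    refine intervalIntegral.integral_mono hab
      ((by fun_prop : Continuous _).intervalIntegrable _ _)
      ((by fun_prop : Continuous _).intervalIntegrable _ _) fun x => ?_
    simp only [mul_left_comm _ (F x), ← Finset.mul_sum]
    rw [Finset.mul_sum]
    exact mul_le_mul_of_nonneg_left
      (prod_le_sum_pow_card_div T hT (fun j => c j x) fun j _ => hc0 j x) (hF0 x)
  rw [intervalIntegral.integral_finsetSum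
    (fun s _ => (by fun_prop : Continuous _).intervalIntegrable _ _)] at h1
  simp only [intervalIntegral.integral_const_mul] at h1
  have h2 := Finset.sum_lt_sum_of_nonempty hT fun j hj =>
    mul_lt_mul_of_pos_left (hlt j hj) (inv_pos.2 hcard)
  rw [Finset.sum_const, nsmul_eq_mul, mul_inv_cancel_left₀ hcard.ne'] at h2
  linarith

/-- The product of the `2 (k - 1)`-th powers of the cosines attached to the generators. -/
noncomputable def cosPowProd (k : ℕ) (L : List (ℤ × ℕ)) (x : ℝ) : ℝ :=
  (L.map fun p => Real.cos (p.1 * x) ^ (2 * (k - 1))).prod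

theorem cosPowProd_cons (k : ℕ) (p : ℤ × ℕ) (L : List (ℤ × ℕ)) (x : ℝ) :
    cosPowProd k (p :: L) x = Real.cos (p.1 * x) ^ (2 * (k - 1)) * cosPowProd k L x := by
  simp [cosPowProd]

theorem continuous_cosPowProd (k : ℕ) (L : List (ℤ × ℕ)) : Continuous (cosPowProd k L) := by
  induction L with
  | nil => exact continuous_const
  | cons p L ih => simp only [funext (cosPowProd_cons k p L)]; fun_prop

theorem cosPowProd_nonneg (k : ℕ) (L : List (ℤ × ℕ)) (x : ℝ) : 0 ≤ cosPowProd k L x := by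
  induction L with
  | nil => simp [cosPowProd]
  | cons p L ih => rw [cosPowProd_cons, pow_mul]; positivity

theorem cosPowProd_le_cosProd {k : ℕ} {L : List (ℤ × ℕ)} (h : Admissible k L) (x : ℝ) :
    cosPowProd k L x ≤ cosProd L x := by
  induction L with
  | nil => simp [cosPowProd, cosProd]
  | cons p L ih =>
    have h0 := cosPowProd_nonneg k L x
    have h1 := Real.cos_sq_le_one (p.1 * x)
    have h2 := h.2.1
    rw [cosPowProd_cons, cosProd_cons, pow_mul, pow_mul]
    exact mul_le_mul (pow_le_pow_of_le_one (sq_nonneg _) h1 (by omega)) (ih h.2.2.2.2) h0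
      (by positivity)

/-- The integral of `∏ |cos (vᵢ x)|` is bounded after replacing all but the factors in `S` by high
powers attached to the generators in `L`. -/
def Replaces {n : ℕ} (v : Fin n → ℤ) (k : ℕ) (L : List (ℤ × ℕ)) (S : Finset (Fin n)) : Prop :=
  Admissible k L ∧ Sᶜ.card ≤ 2 * (k - 1) * L.length ∧
    ∫ x in (0 : ℝ)..2 * Real.pi, ∏ i, |Real.cos (v i * x)| ≤
      ∫ x in (0 : ℝ)..2 * Real.pi, cosPowProd k L x * ∏ i ∈ S, |Real.cos (v i * x)|

theorem Replaces.sq_integral_mul_orderProd_le {n : ℕ} {v : Fin n → ℤ} {k : ℕ} {L : List (ℤ × ℕ)}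
    {S : Finset (Fin n)} (h : Replaces v k L S) :
    (∫ x in (0 : ℝ)..2 * Real.pi, ∏ i, |Real.cos (v i * x)|) ^ 2 * orderProd L ≤
      (2 * Real.pi) ^ 2 := by
  obtain ⟨hL, -, hI⟩ := h
  refine le_trans ?_ (integral_cosProd_nonneg_and_sq_mul_le hL).2
  have hpi := Real.two_pi_pos.le
  gcongr
  · exact intervalIntegral.integral_nonneg hpi fun x _ =>
      Finset.prod_nonneg fun i _ => abs_nonneg _
  · refine hI.trans (intervalIntegral.integral_mono hpi
      (((continuous_cosPowProd k L).mul (by fun_prop)).intervalIntegrable _ _)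
      ((continuous_cosProd L).intervalIntegrable _ _) fun x => ?_)
    refine (mul_le_of_le_one_right (cosPowProd_nonneg k L x) ?_).trans (cosPowProd_le_cosProd hL x)
    exact Finset.prod_le_one (fun i _ => abs_nonneg _) fun i _ => Real.abs_cos_le_one _

theorem exists_admissible_cons {k : ℕ} (hk : 2 ≤ k) {L : List (ℤ × ℕ)} (hL : Admissible k L)
    {w : ℤ} (hw : w ∉ boxSums L) : ∃ s : ℕ, Admissible k ((w, s) :: L) := by
  classical
  have hex : ∃ s : ℕ, 0 < s ∧ (s = k ∨ (s : ℤ) * w ∈ boxSums L) := ⟨k, by omega, Or.inl rfl⟩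
  obtain ⟨h0, hs⟩ := Nat.find_spec hex
  refine ⟨Nat.find hex, ?_, Nat.find_min' hex ⟨by omega, Or.inl rfl⟩, ?_, hs, hL⟩
  · by_contra hlt
    have h1 : Nat.find hex = 1 := by simp only at hlt; omega
    rw [h1] at hs
    rcases hs with hs | hs
    · omega
    · exact hw (by simpa using hs)
  · intro t ht0 ht hmem
    exact Nat.find_min hex ht ⟨ht0, Or.inr hmem⟩

theorem Replaces.exists_cons {n : ℕ} {v : Fin n → ℤ} {k : ℕ} (hk : 2 ≤ k) {L : List (ℤ × ℕ)}
    {S T : Finset (Fin n)} (h : Replaces v k L S) (hTS : T ⊆ S) (hT : T.card = 2 * (k - 1))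
    (hbad : ∀ j ∈ T, v j ∉ boxSums L) :
    ∃ p, Replaces v k (p :: L) (S \ T) := by
  obtain ⟨hL, hcard, hI⟩ := h
  have hcont := continuous_cosPowProd k L
  obtain ⟨j, hj, hle⟩ := exists_integral_mul_prod_le T (Finset.card_pos.1 (by omega))
    (fun x => cosPowProd k L x * ∏ i ∈ S \ T, |Real.cos (v i * x)|)
    (fun i x => |Real.cos (v i * x)|) (by fun_prop) (fun i => by fun_prop)
    (fun x => mul_nonneg (cosPowProd_nonneg k L x) (Finset.prod_nonneg fun i _ => abs_nonneg _))
    (fun i x => abs_nonneg _) Real.two_pi_pos.le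
  obtain ⟨s, hs⟩ := exists_admissible_cons hk hL (hbad j hj)
  refine ⟨(v j, s), hs, ?_, hI.trans (le_of_eq_of_le ?_ (hle.trans_eq ?_))⟩
  · rw [List.length_cons, mul_add, mul_one, ← hT]
    have : (S \ T)ᶜ = Sᶜ ∪ T := by ext; simp; tauto
    rw [this]
    exact (Finset.card_union_le _ _).trans (by rw [hT]; omega)
  · refine intervalIntegral.integral_congr fun x _ => ?_
    rw [mul_assoc, Finset.prod_sdiff hTS]
  · refine intervalIntegral.integral_congr fun x _ => ?_
    rw [cosPowProd_cons, hT, pow_mul, sq_abs, ← pow_mul]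
    ring

theorem exists_admissible_covering {n : ℕ} (v : Fin n → ℤ) {k : ℕ} (hk : 2 ≤ k) {ρ : ℝ} (hρ : 0 < ρ)
    (h : ρ ≤ (Nat.card {s : Fin n → Bool // ∑ i, (if s i then v i else -v i) = 0} : ℝ) / 2 ^ n) :
    ∃ L, Admissible k L ∧ ρ ^ 2 * orderProd L ≤ 1 ∧
      Nat.card {j : Fin n // v j ∉ boxSums L} ≤ 2 * (k - 1) * (L.length + 1) := by
  classical
  have hpi := Real.two_pi_pos
  have hI : 2 * Real.pi * ρ ≤ ∫ x in (0 : ℝ)..2 * Real.pi, ∏ i, |Real.cos (v i * x)| := by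
    refine (mul_le_mul_of_nonneg_left h hpi.le).trans ?_
    rw [← integral_prod_cos]
    refine intervalIntegral.integral_mono hpi.le
      ((by fun_prop : Continuous _).intervalIntegrable _ _)
      ((by fun_prop : Continuous _).intervalIntegrable _ _) fun x => ?_
    simp only [← Finset.abs_prod]
    exact le_abs_self _
  have hbound : ∀ L S, Replaces v k L S → ρ ^ 2 * orderProd L ≤ 1 := by
    intro L S hR
    have h1 := hR.sq_integral_mul_orderProd_le
    have h2 : (2 * Real.pi * ρ) ^ 2 * orderProd L ≤ (2 * Real.pi) ^ 2 * 1 := by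
      rw [mul_one]
      refine le_trans ?_ h1
      gcongr
    rw [mul_pow, mul_assoc] at h2
    exact le_of_mul_le_mul_left h2 (by positivity)
  by_contra! hcon
  have hlen : ∀ m : ℕ, ∃ L S, L.length = m ∧ Replaces v k L S := by
    intro m
    induction m with
    | zero => exact ⟨[], Finset.univ, rfl, trivial, by simp, by simp [cosPowProd]⟩
    | succ m ih =>
      obtain ⟨L, S, hm, hR⟩ := ih
      have hbad := hcon L hR.1 (hbound L S hR)
      rw [Nat.card_eq_fintype_card, Fintype.card_subtype, mul_add, mul_one] at hbad
      set U := Finset.univ.filter fun j => v j ∉ boxSums L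
      have hU : U ⊆ (U ∩ S) ∪ Sᶜ := fun i hi => by
        by_cases hiS : i ∈ S <;> simp [hiS, hi]
      have hc := (Finset.card_le_card hU).trans (Finset.card_union_le _ _)
      have hS := hR.2.1
      obtain ⟨T, hTU, hT⟩ := Finset.exists_subset_card_eq
        (show 2 * (k - 1) ≤ (U ∩ S).card by omega)
      obtain ⟨p, hp⟩ := hR.exists_cons hk (hTU.trans Finset.inter_subset_right) hT fun j hj =>
        (Finset.mem_filter.1 (Finset.mem_inter.1 (hTU hj)).1).2
      exact ⟨p :: L, _, by simp [hm], hp⟩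
  obtain ⟨m, hm⟩ := pow_unbounded_of_one_lt (1 / ρ ^ 2) (one_lt_two (α := ℝ))
  obtain ⟨L, S, rfl, hR⟩ := hlen m
  have h1 := hbound L S hR
  have h2 : (2 : ℝ) ^ L.length ≤ orderProd L := by
    exact_mod_cast two_pow_length_le_orderProd hR.1
  rw [div_lt_iff₀ (by positivity)] at hm
  nlinarith [sq_nonneg ρ]

theorem exists_integral_coordinates {k d : ℕ} {L : List (ℤ × ℕ)} (hk : 2 ≤ k) (h : Admissible k L)
    (hd : orderProd L < k ^ (d + 1)) :
    ∃ a : Fin d → ℤ, ∀ y ∈ boxSums L, ∃ t : Fin d → ℤ,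
      (∀ i, |t i| ≤ (k * orderProd L ^ (d + 2) : ℕ)) ∧ y = ∑ i, t i * a i := by
  have hP := (pow_pos two_pos _).trans_le (two_pow_length_le_orderProd h)
  obtain ⟨r, hr, w, hw⟩ := exists_rational_coordinates h
  have hrd : r ≤ d := Nat.lt_succ_iff.1 ((Nat.pow_lt_pow_iff_right hk).1 (hr.trans_lt hd))
  obtain ⟨e, rfl⟩ := Nat.exists_eq_add_of_le hrd
  obtain ⟨a, ha⟩ := exists_integral_generators (orderProd L) hP r w
  refine ⟨Fin.append a 0, fun y hy => ?_⟩
  obtain ⟨z, hz, hzy⟩ := hw y hy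
  obtain ⟨t, ht, hty⟩ := ha _ z hz ⟨y, hzy.symm⟩
  have hP1 : (1 : ℤ) ≤ orderProd L := by exact_mod_cast hP
  refine ⟨Fin.append t 0, fun i => ?_, ?_⟩
  · refine Fin.addCases (fun i => ?_) (fun i => ?_) i
    · rw [Fin.append_left]
      refine (ht i).trans ?_
      push_cast
      rw [mul_assoc, ← pow_add]
      exact mul_le_mul_of_nonneg_left (pow_le_pow_right₀ hP1 (by omega)) (by positivity)
    · rw [Fin.append_right]
      simp only [Pi.zero_apply, abs_zero]
      positivity
  · rw [Fin.sum_univ_add]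
    simp only [Fin.append_left, Fin.append_right, Pi.zero_apply, mul_zero, Finset.sum_const_zero,
      add_zero]
    exact mul_left_cancel₀ (by omega : (orderProd L : ℤ) ≠ 0) (hzy.trans hty)

theorem exists_forall_ge_log_le_rpow (A : ℝ) {β : ℝ} (hβ : 0 < β) :
    ∃ N : ℕ, ∀ n : ℕ, N ≤ n → 2 * (4 * A * Real.log n + 1) ≤ (n : ℝ) ^ β := by
  have h1 := ((isLittleO_log_rpow_atTop hβ).const_mul_left (8 * A)).bound
    (by norm_num : (0 : ℝ) < 1 / 2)
  have h2 := (tendsto_rpow_atTop hβ).eventually_ge_atTop 4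
  have h3 := tendsto_natCast_atTop_atTop (R := ℝ) |>.eventually (h1.and h2)
  obtain ⟨N, hN⟩ := Filter.eventually_atTop.1 h3
  refine ⟨N, fun n hn => ?_⟩
  obtain ⟨h4, h5⟩ := hN n hn
  rw [Real.norm_eq_abs, Real.norm_eq_abs, abs_of_nonneg (by positivity : 0 ≤ (n : ℝ) ^ β)] at h4
  linarith [le_abs_self (8 * A * Real.log n)]

/-- **Inverse Littlewood–Offord theorem** (Tao–Vu). For all constants `A, α > 0` there
exist constants `d` (the rank bound) and `B` (the volume exponent) such that for all
sufficiently large `n`: if `v : Fin n → ℤ` is a multiset of integers for which the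
probability that the random `±1`-signed sum `∑ i, ξ i * v i` vanishes is at least
`n ^ (-A)` (signs modeled by a uniform `s : Fin n → Bool`), then there is a generalized
arithmetic progression `Q = {c + ∑ i, m i * a i | M i ≤ m i ≤ M' i}` of rank at most `d`
and volume `∏ i, (M' i - M i + 1)` at most `n ^ B` containing all but at most `n ^ α`
of the elements `v j` (counting multiplicity). -/
theorem inverse_littlewood_offord (A α : ℝ) (hA : 0 < A) (hα : 0 < α) :
    ∃ d : ℕ, ∃ B : ℝ, ∃ N : ℕ, ∀ n : ℕ, N ≤ n → ∀ v : Fin n → ℤ,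
      (n : ℝ) ^ (-A) ≤
        (Nat.card {s : Fin n → Bool // ∑ i, (if s i then v i else -v i) = 0} : ℝ) / 2 ^ n →
      ∃ c : ℤ, ∃ a M M' : Fin d → ℤ, (∀ i, M i ≤ M' i) ∧
        (∏ i, ((M' i - M i + 1 : ℤ) : ℝ)) ≤ (n : ℝ) ^ B ∧
        (Nat.card {j : Fin n // ¬ ∃ m : Fin d → ℤ,
            (∀ i, M i ≤ m i ∧ m i ≤ M' i) ∧ v j = c + ∑ i, m i * a i} : ℝ) ≤ (n : ℝ) ^ α := by
  obtain ⟨N, hN⟩ := exists_forall_ge_log_le_rpow A (half_pos hα)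
  obtain ⟨d, hd⟩ := exists_nat_ge (8 * A / α)
  refine ⟨d, (3 + α / 4 + 2 * A * (d + 2)) * d, max N 2, fun n hn v hv => ?_⟩
  have hn2 : 2 ≤ n := (le_max_right _ _).trans hn
  have hn2' : (2 : ℝ) ≤ n := by exact_mod_cast hn2
  have hn0 : (0 : ℝ) < n := by linarith
  have hn1 : (1 : ℝ) < n := by linarith
  set k := ⌈(n : ℝ) ^ (α / 4)⌉₊
  have hx1 : 1 < (n : ℝ) ^ (α / 4) := Real.one_lt_rpow hn1 (by positivity)
  have hkx : (n : ℝ) ^ (α / 4) ≤ k := Nat.le_ceil _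
  have hkx' : (k : ℝ) < (n : ℝ) ^ (α / 4) + 1 := Nat.ceil_lt_add_one (by positivity)
  have hk : 2 ≤ k := Nat.one_lt_cast.1 (hx1.trans_le hkx)
  obtain ⟨L, hL, hρ, hcard⟩ := exists_admissible_covering v hk (by positivity) hv
  have hP : (orderProd L : ℝ) ≤ (n : ℝ) ^ (2 * A) := by
    rw [← Real.rpow_natCast, ← Real.rpow_mul hn0.le, mul_comm, ← le_div_iff₀ (by positivity),
      one_div, ← Real.rpow_neg hn0.le] at hρ
    refine hρ.trans_eq ?_
    push_cast
    ring_nf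
  have hPk : orderProd L < k ^ (d + 1) := by
    have h1 : (n : ℝ) ^ (2 * A) < (k : ℝ) ^ (d + 1) := by
      calc (n : ℝ) ^ (2 * A) < (n : ℝ) ^ (α / 4 * (d + 1 : ℕ)) := by
            refine Real.rpow_lt_rpow_of_exponent_lt hn1 ?_
            rw [div_le_iff₀ hα] at hd
            push_cast
            nlinarith
        _ = ((n : ℝ) ^ (α / 4)) ^ (d + 1) := by rw [Real.rpow_mul hn0.le, Real.rpow_natCast]
        _ ≤ (k : ℝ) ^ (d + 1) := by gcongr
    exact_mod_cast hP.trans_lt h1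
  obtain ⟨a, ha⟩ := exists_integral_coordinates hk hL hPk
  have hP0 := (pow_pos two_pos _).trans_le (two_pow_length_le_orderProd hL)
  set T := k * orderProd L ^ (d + 2) with hT
  have hT1 : 1 ≤ T := Nat.mul_pos (by omega) (pow_pos hP0 _)
  refine ⟨0, a, fun _ => -T, fun _ => T, fun _ => by lia, ?_, ?_⟩
  · rw [Finset.prod_const, Finset.card_univ, Fintype.card_fin, Real.rpow_mul hn0.le,
      Real.rpow_natCast]
    push_cast
    have hTr : (1 : ℝ) ≤ T := by exact_mod_cast hT1
    refine pow_le_pow_left₀ (by linarith) ?_ _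
    calc (T - -T + 1 : ℝ) ≤ 3 * T := by linarith
      _ = 3 * (k * (orderProd L : ℝ) ^ (d + 2)) := by rw [hT]; push_cast; rfl
      _ ≤ 3 * (2 * (n : ℝ) ^ (α / 4) * ((n : ℝ) ^ (2 * A)) ^ (d + 2)) := by
          gcongr
          linarith
      _ = 6 * ((n : ℝ) ^ (α / 4) * (n : ℝ) ^ (2 * A * (d + 2))) := by
          rw [Real.rpow_mul hn0.le (2 * A), ← Real.rpow_natCast]
          push_cast
          ring
      _ ≤ (n : ℝ) ^ (3 : ℝ) * ((n : ℝ) ^ (α / 4) * (n : ℝ) ^ (2 * A * (d + 2))) := by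
          gcongr
          have : (2 : ℝ) ^ (3 : ℝ) ≤ (n : ℝ) ^ (3 : ℝ) := by gcongr
          norm_num at this ⊢
          linarith
      _ = _ := by rw [← Real.rpow_add hn0, ← Real.rpow_add hn0, add_assoc]
  · have hsub : Nat.card {j : Fin n // ¬ ∃ m : Fin d → ℤ,
        (∀ i, -(T : ℤ) ≤ m i ∧ m i ≤ T) ∧ v j = 0 + ∑ i, m i * a i} ≤
        Nat.card {j : Fin n // v j ∉ boxSums L} := by
      refine Nat.card_le_card_of_injective
        (Subtype.map id fun j hj hmem => hj ?_) (Subtype.map_injective _ Function.injective_id)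
      obtain ⟨t, ht, hvt⟩ := ha _ hmem
      exact ⟨t, fun i => abs_le.1 (ht i), by rw [zero_add]; exact hvt⟩
    have hlen : (L.length : ℝ) ≤ 4 * A * Real.log n := by
      have h1 : (2 : ℝ) ^ L.length ≤ (n : ℝ) ^ (2 * A) :=
        le_trans (by exact_mod_cast two_pow_length_le_orderProd hL) hP
      have h2 := Real.log_le_log (by positivity) h1
      rw [Real.log_pow, Real.log_rpow hn0] at h2
      nlinarith [Real.log_two_gt_d9, (Nat.cast_nonneg L.length : (0 : ℝ) ≤ _)]
    have hk1 : ((k - 1 : ℕ) : ℝ) ≤ (n : ℝ) ^ (α / 4) := by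
      rw [Nat.cast_sub (by omega)]
      push_cast
      linarith
    calc _ ≤ ((2 * (k - 1) * (L.length + 1) : ℕ) : ℝ) := by exact_mod_cast hsub.trans hcard
      _ = (k - 1 : ℕ) * (2 * (L.length + 1)) := by push_cast; ring
      _ ≤ (n : ℝ) ^ (α / 4) * (2 * (4 * A * Real.log n + 1)) := by gcongr
      _ ≤ (n : ℝ) ^ (α / 4) * (n : ℝ) ^ (α / 2) := by
          gcongr
          exact hN n ((le_max_left _ _).trans hn)
      _ = (n : ℝ) ^ (α / 4 + α / 2) := (Real.rpow_add hn0 _ _).symm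
      _ ≤ (n : ℝ) ^ α := Real.rpow_le_rpow_of_exponent_le hn1.le (by linarith)
end
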